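/- arXiv:2403.11584 — 7 statements merged into one kernel-verified Lean document; each statement's English description precedes it below -/
import Mathlib

section
/- Let Ω ⊂ ℝⁿ be open and bounded and let J_ε be the rescaled kernel of the general (non-periodic) case. Then the set b_ε[Ω̄] = { −∫_Ω J_ε(x−y) dy : x ∈ Ω̄ } is contained in the spectrum of the bounded linear operator 𝓛_ε on L²(Ω). -/
open MeasureTheory Real Filter

noncomputable section

/-- Rescaled kernel of the general (non-periodic) case:
`J_ε(z) = (C_norm / ε^(m+n)) J(z/ε)` with `C_norm = (½ ∫ J(w)|w|² dw)⁻¹`. -/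
def Jeps (n : ℕ) (J : (Fin n → ℝ) → ℝ) (ε m : ℝ) (z : Fin n → ℝ) : ℝ :=
  ((2 : ℝ)⁻¹ * ∫ w : Fin n → ℝ, J w * ∑ i, (w i) ^ 2)⁻¹ / ε ^ (m + (n : ℝ)) * J (ε⁻¹ • z)

/-- Nonlocal dispersion operator `𝓛 u (x) = ∫_Ω K(x-y) (u y - u x) dy`. -/
def Lop {n : ℕ} (Ω : Set (Fin n → ℝ)) (K : (Fin n → ℝ) → ℝ)
    (u : (Fin n → ℝ) → ℝ) (x : Fin n → ℝ) : ℝ :=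
  ∫ y in Ω, K (x - y) * (u y - u x)

/-- `b_ε(x) = -∫_Ω K(x-y) dy`. -/
def beps {n : ℕ} (Ω : Set (Fin n → ℝ)) (K : (Fin n → ℝ) → ℝ) (x : Fin n → ℝ) : ℝ :=
  - ∫ y in Ω, K (x - y)

theorem beps_cont_aux {n : ℕ} (Ω : Set (Fin n → ℝ)) (hΩb : Bornology.IsBounded Ω)
    (K : (Fin n → ℝ) → ℝ) (hK : Continuous K) (M : ℝ) (hM : ∀ z, |K z| ≤ M) :
    Continuous (beps Ω K) := by
  have hfin : volume Ω < ⊤ := hΩb.measure_lt_top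
  have : IsFiniteMeasure (volume.restrict Ω) := ⟨by simpa using hfin⟩
  unfold beps
  refine Continuous.neg ?_
  refine continuous_of_dominated (bound := fun _ => M) ?_ ?_ ?_ ?_
  · intro x
    exact (hK.comp (by fun_prop : Continuous fun y => x - y)).aestronglyMeasurable
  · intro x
    exact Eventually.of_forall fun y => hM _
  · exact integrable_const _
  · exact Eventually.of_forall fun y => hK.comp (by fun_prop : Continuous fun x => x - y)

theorem approx_aux {n : ℕ} (Ω : Set (Fin n → ℝ)) (hΩb : Bornology.IsBounded Ω)
    (K : (Fin n → ℝ) → ℝ) (hK : Continuous K) (M : ℝ) (hM0 : 0 ≤ M) (hM : ∀ z, |K z| ≤ M)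
    (T : Lp ℝ 2 (volume.restrict Ω) →L[ℝ] Lp ℝ 2 (volume.restrict Ω))
    (hT : ∀ u : Lp ℝ 2 (volume.restrict Ω),
      (T u : (Fin n → ℝ) → ℝ) =ᵐ[volume.restrict Ω] fun x => Lop Ω K u x)
    (l η : ℝ) (hη : 0 ≤ η) (s : Set (Fin n → ℝ)) (hs : MeasurableSet s)
    (hsfin : volume.restrict Ω s ≠ ⊤)
    (hb : ∀ x ∈ s, |beps Ω K x - l| ≤ η) :
    ‖T (indicatorConstLp 2 hs hsfin 1) - l • (indicatorConstLp 2 hs hsfin (1 : ℝ))‖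
      ≤ (M * √((volume.restrict Ω).real s) * √((volume.restrict Ω).real Set.univ) + η)
        * √((volume.restrict Ω).real s) := by
  have hfin : volume Ω < ⊤ := hΩb.measure_lt_top
  have : IsFiniteMeasure (volume.restrict Ω) := ⟨by simpa using hfin⟩
  set u := indicatorConstLp 2 hs hsfin (1 : ℝ) with hu
  set c := indicatorConstLp (μ := volume.restrict Ω) 2 MeasurableSet.univ (measure_ne_top _ _) (M * (volume.restrict Ω).real s)
    with hc
  have hus : (u : (Fin n → ℝ) → ℝ) =ᵐ[volume.restrict Ω] s.indicator fun _ => (1 : ℝ) :=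
    indicatorConstLp_coeFn
  have hcs : (c : (Fin n → ℝ) → ℝ) =ᵐ[volume.restrict Ω] Set.univ.indicator fun _ => M * (volume.restrict Ω).real s :=
    indicatorConstLp_coeFn
  have hKi : ∀ x, Integrable (fun y => K (x - y)) (volume.restrict Ω) := fun x =>
    Integrable.of_bound
      (hK.comp (by fun_prop : Continuous fun y => x - y)).aestronglyMeasurable M
      (Eventually.of_forall fun y => hM _)
  have hnu : ‖u‖ = √((volume.restrict Ω).real s) := by
    rw [hu, norm_indicatorConstLp (by norm_num) (by norm_num), Real.sqrt_eq_rpow]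
    norm_num
  have hnc : ‖c‖ = M * (volume.restrict Ω).real s * √((volume.restrict Ω).real Set.univ) := by
    rw [hc, norm_indicatorConstLp (by norm_num) (by norm_num), Real.sqrt_eq_rpow]
    rw [Real.norm_of_nonneg (by positivity)]
    norm_num
  have key : ‖T u - l • u‖ ≤ ‖c + η • u‖ := by
    apply Lp.norm_le_norm_of_ae_le
    filter_upwards [hT u, hus, hcs, Lp.coeFn_sub (T u) (l • u), Lp.coeFn_smul l u,
      Lp.coeFn_add c (η • u), Lp.coeFn_smul η u] with x h1 h2 h3 h4 h5 h6 h7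
    rw [h4, h6]
    simp only [Pi.sub_apply, Pi.add_apply]
    rw [h5, h7]
    simp only [Pi.smul_apply, smul_eq_mul]
    rw [h1, h3, Set.indicator_univ]
    have e : Lop Ω K u x = (∫ y in s, K (x - y) ∂(volume.restrict Ω)) + beps Ω K x * u x := by
      unfold Lop beps
      have e1 : ∫ y in Ω, K (x - y) * (u y - u x)
          = ∫ y, (s.indicator (fun y => K (x - y)) y - K (x - y) * u x) ∂(volume.restrict Ω) := by
        apply integral_congr_ae
        filter_upwards [hus] with y hy
        rw [hy]
        by_cases hys : y ∈ s <;> simp [hys] <;> ring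
      rw [e1, integral_sub ((hKi x).indicator hs) ((hKi x).mul_const _),
        integral_indicator hs, integral_mul_const]
      ring
    rw [e]
    have hI : |∫ y in s, K (x - y) ∂(volume.restrict Ω)| ≤ M * (volume.restrict Ω).real s := by
      have := norm_setIntegral_le_of_norm_le_const (μ := volume.restrict Ω) (s := s) (C := M)
        (f := fun y => K (x - y)) (by exact hsfin.lt_top) (fun y _ => hM _)
      simpa using this
    have h8 : |(beps Ω K x - l) * u x| ≤ η * u x := by
      rw [h2]
      by_cases hx : x ∈ s
      · simpa [hx] using hb x hx
      · simp [hx]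
    have h9 : (∫ y in s, K (x - y) ∂(volume.restrict Ω)) + beps Ω K x * u x - l * u x
        = (∫ y in s, K (x - y) ∂(volume.restrict Ω)) + (beps Ω K x - l) * u x := by ring
    rw [h9, Real.norm_eq_abs, Real.norm_eq_abs]
    calc _ ≤ _ := abs_add_le _ _
      _ ≤ M * (volume.restrict Ω).real s + η * u x := add_le_add hI h8
      _ ≤ _ := le_abs_self _
  refine key.trans ((norm_add_le _ _).trans ?_)
  rw [norm_smul, hnu, hnc, Real.norm_of_nonneg hη]
  have := Real.mul_self_sqrt (measureReal_nonneg (μ := volume.restrict Ω) (s := s))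
  apply le_of_eq
  linear_combination (-M * √((volume.restrict Ω).real Set.univ)) * this

theorem main_aux {n : ℕ} (Ω : Set (Fin n → ℝ)) (hΩo : IsOpen Ω)
    (hΩb : Bornology.IsBounded Ω)
    (K : (Fin n → ℝ) → ℝ) (hK : Continuous K) (M : ℝ) (hM0 : 0 ≤ M) (hM : ∀ z, |K z| ≤ M)
    (hMn : n = 0 → M = 0)
    (T : Lp ℝ 2 (volume.restrict Ω) →L[ℝ] Lp ℝ 2 (volume.restrict Ω))
    (hT : ∀ u : Lp ℝ 2 (volume.restrict Ω),
      (T u : (Fin n → ℝ) → ℝ) =ᵐ[volume.restrict Ω] fun x => Lop Ω K u x)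
    (x₀ : Fin n → ℝ) (hx₀ : x₀ ∈ closure Ω) : beps Ω K x₀ ∈ spectrum ℝ T := by
  have hfin : volume Ω < ⊤ := hΩb.measure_lt_top
  have : IsFiniteMeasure (volume.restrict Ω) := ⟨by simpa using hfin⟩
  rw [spectrum.mem_iff]
  rintro ⟨U, hU⟩
  set R : Lp ℝ 2 (volume.restrict Ω) →L[ℝ] Lp ℝ 2 (volume.restrict Ω) := ↑U⁻¹ with hR
  have hRU : R * (algebraMap ℝ _ (beps Ω K x₀) - T) = 1 := by
    rw [← hU, hR]; exact U.inv_mul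
  set η : ℝ := 1 / (4 * (‖R‖ + 1)) with hηd
  have hR0 : 0 ≤ ‖R‖ := norm_nonneg R
  have hη : 0 < η := by positivity
  set A := √((volume.restrict Ω).real Set.univ) with hA
  -- choice of the radius
  have hev1 : ∀ᶠ r in nhdsWithin (0:ℝ) (Set.Ioi 0), M * √((2 * r) ^ n) * A < η := by
    have hc : Continuous fun r : ℝ => M * √((2 * r) ^ n) * A := by fun_prop
    have h0 : M * √((2 * (0:ℝ)) ^ n) * A = 0 := by
      rcases Nat.eq_zero_or_pos n with h | h
      · simp [hMn h]
      · simp [h.ne']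
    have := hc.tendsto 0
    rw [h0] at this
    exact (this.mono_left nhdsWithin_le_nhds).eventually (gt_mem_nhds hη)
  obtain ⟨δ, hδ, hδb⟩ := Metric.continuous_iff.1 (beps_cont_aux Ω hΩb K hK M hM) x₀ η hη
  have hev2 : ∀ᶠ r in nhdsWithin (0:ℝ) (Set.Ioi 0), r < δ :=
    (eventually_lt_nhds hδ).filter_mono nhdsWithin_le_nhds
  obtain ⟨r, ⟨hr1, hr2⟩, hr0⟩ := ((hev1.and hev2).and self_mem_nhdsWithin).exists
  have hr0 : 0 < r := hr0
  have hso : IsOpen (Ω ∩ Metric.ball x₀ r) := hΩo.inter Metric.isOpen_ball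
  have hne : (Ω ∩ Metric.ball x₀ r).Nonempty := by
    obtain ⟨y, hy, hd⟩ := Metric.mem_closure_iff.1 hx₀ r hr0
    exact ⟨y, hy, by rwa [Metric.mem_ball, dist_comm]⟩
  set s := Ω ∩ Metric.ball x₀ r with hs
  have hsm : MeasurableSet s := hso.measurableSet
  have hvs : volume.restrict Ω s = volume s := by
    rw [Measure.restrict_apply hsm, Set.inter_eq_left.2 Set.inter_subset_left]
  have hsfin : volume.restrict Ω s ≠ ⊤ := measure_ne_top _ _
  have hpos : 0 < (volume.restrict Ω).real s := by
    rw [measureReal_def, hvs]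
    exact ENNReal.toReal_pos (hso.measure_pos volume hne).ne' (hvs ▸ hsfin)
  have hle : (volume.restrict Ω).real s ≤ (2 * r) ^ n := by
    rw [measureReal_def, hvs]
    apply ENNReal.toReal_le_of_le_ofReal (by positivity)
    refine (measure_mono Set.inter_subset_right).trans ?_
    rw [Real.volume_pi_ball _ hr0]
    simp
  have happ := approx_aux Ω hΩb K hK M hM0 hM T hT (beps Ω K x₀) η hη.le s hsm hsfin
    (fun x hx => (hδb x (lt_trans hx.2 hr2)).le)
  set u := indicatorConstLp 2 hsm hsfin (1 : ℝ) with hu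
  have hnu : ‖u‖ = √((volume.restrict Ω).real s) := by
    rw [hu, norm_indicatorConstLp (by norm_num) (by norm_num), Real.sqrt_eq_rpow]
    norm_num
  have hsq : 0 < √((volume.restrict Ω).real s) := Real.sqrt_pos.2 hpos
  have hsmall : M * √((volume.restrict Ω).real s) * A + η ≤ 2 * η := by
    have : M * √((volume.restrict Ω).real s) * A ≤ M * √((2 * r) ^ n) * A := by gcongr
    linarith
  have hRu : R ((algebraMap ℝ (Lp ℝ 2 (volume.restrict Ω) →L[ℝ] Lp ℝ 2 (volume.restrict Ω))
      (beps Ω K x₀) - T) u) = u := by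
    have := congrArg (fun f : Lp ℝ 2 (volume.restrict Ω) →L[ℝ] Lp ℝ 2 (volume.restrict Ω) =>
      f u) hRU
    simpa using this
  have h1 : ‖u‖ ≤ ‖R‖ * ‖T u - beps Ω K x₀ • u‖ := by
    calc ‖u‖ = _ := by rw [← hRu]
      _ ≤ _ := R.le_opNorm _
      _ = _ := by
        congr 1
        rw [← norm_neg]
        congr 1
        simp [Algebra.algebraMap_eq_smul_one]
  rw [hnu] at h1
  have h2 : ‖T u - beps Ω K x₀ • u‖ ≤ 2 * η * √((volume.restrict Ω).real s) :=
    happ.trans (by gcongr)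
  have h3 : ‖R‖ * (2 * η) < 1 := by
    rw [hηd]
    field_simp
    linarith
  have h4 := h1.trans (mul_le_mul_of_nonneg_left h2 hR0)
  nlinarith

/-- the set `b_ε[Ω̄]` is contained in the spectrum of the bounded
linear operator `𝓛_ε` on `L²(Ω)`. -/
theorem stmt0 {n : ℕ} (Ω : Set (Fin n → ℝ)) (hΩo : IsOpen Ω)
    (hΩb : Bornology.IsBounded Ω)
    (J : (Fin n → ℝ) → ℝ) (hJc : Continuous J) (hJnn : ∀ z, 0 ≤ J z) (hJ0 : 0 < J 0)
    (hJsymm : ∀ z, J (-z) = J z)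
    (hJdec : Tendsto J (cocompact (Fin n → ℝ)) (nhds 0))
    (hJ2 : Integrable (fun z : Fin n → ℝ => J z * ∑ i, (z i) ^ 2))
    (hJ1 : (∫ z : Fin n → ℝ, J z) = 1)
    (ε m : ℝ) (hε : 0 < ε) (hm : m ∈ Set.Icc (0 : ℝ) 2)
    (T : Lp ℝ 2 (volume.restrict Ω) →L[ℝ] Lp ℝ 2 (volume.restrict Ω))
    (hT : ∀ u : Lp ℝ 2 (volume.restrict Ω),
      (T u : (Fin n → ℝ) → ℝ) =ᵐ[volume.restrict Ω]
        fun x => Lop Ω (Jeps n J ε m) u x) :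
    ∀ x ∈ closure Ω, beps Ω (Jeps n J ε m) x ∈ spectrum ℝ T := by
  have hKc : Continuous (Jeps n J ε m) := by
    unfold Jeps
    exact continuous_const.mul (hJc.comp (continuous_const_smul _))
  rcases Nat.eq_zero_or_pos n with h | h
  · subst h
    have hz : ∀ z, |Jeps 0 J ε m z| ≤ 0 := by
      intro z
      simp [Jeps]
    exact main_aux Ω hΩo hΩb _ hKc 0 le_rfl hz (fun _ => rfl) T hT
  · obtain ⟨B, hB⟩ : ∃ B, ∀ z, |J z| ≤ B := by
      obtain ⟨B, hB⟩ := hJc.exists_forall_ge' (x₀ := (0 : Fin n → ℝ))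
        ((hJdec.eventually (gt_mem_nhds hJ0)).mono fun _ h => h.le)
      exact ⟨J B, fun z => by rw [abs_of_nonneg (hJnn z)]; exact hB z⟩
    set C := ((2 : ℝ)⁻¹ * ∫ w : Fin n → ℝ, J w * ∑ i, (w i) ^ 2)⁻¹ / ε ^ (m + (n : ℝ)) with hC
    have hB0 : 0 ≤ B := (abs_nonneg _).trans (hB 0)
    refine main_aux Ω hΩo hΩb _ hKc (|C| * B) (by positivity) ?_ (fun h0 => by omega) T hT
    intro z
    unfold Jeps
    rw [abs_mul]
    exact mul_le_mul_of_nonneg_left (hB _) (abs_nonneg _)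
end
end

section
/- Let Ω ⊂ ℝⁿ be open and bounded and let J_ε be the rescaled kernel of the general (non-periodic) case. Then every element λ of the spectrum of 𝓛 _ε on L²(Ω) which does not belong to the set b_ε[Ω̄] = { −∫_Ω J_ε(x−y) dy : x ∈ Ω̄ } is an eigenvalue of 𝓛_ε, i.e. there exists a nonzero φ ∈ L²(Ω) with 𝓛_ε φ = λ φ. -/
open MeasureTheory Real Filter

noncomputable section

/-- Operators with kernel in `L²(μ; E)` are compact. -/
theorem isCompactOperator_hs {α E : Type*} [MeasurableSpace α] {μ : Measure α}
    [NormedAddCommGroup E] [InnerProductSpace ℝ E] (g : Lp E 2 μ) :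
    IsCompactOperator
      (((innerSL ℝ : E →L[ℝ] E →L[ℝ] ℝ).compLpL₂ 2 μ).flip g) := by
  refine Lp.induction (by simp) (motive := fun g => IsCompactOperator
      (((innerSL ℝ : E →L[ℝ] E →L[ℝ] ℝ).compLpL₂ 2 μ).flip g)) ?_ ?_ ?_ g
  · intro c s hs hμs
    have h1 : IsCompactOperator (innerSL ℝ c : E →L[ℝ] ℝ) := by
      refine ⟨Metric.closedBall 0 1, isCompact_closedBall _ _, ?_⟩
      exact (innerSL ℝ c).continuous.continuousAt.preimage_mem_nhds
        (by rw [map_zero]; exact Metric.closedBall_mem_nhds _ one_pos)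
    have h2 := h1.clm_comp
      (ContinuousLinearMap.toSpanSingleton ℝ (indicatorConstLp 2 hs hμs.ne (1 : ℝ)))
    refine (congrArg IsCompactOperator (funext fun u => ?_)).mpr h2
    simp only [ContinuousLinearMap.flip_apply, ContinuousLinearMap.compLpL₂_apply_apply,
      Function.comp_apply, ContinuousLinearMap.toSpanSingleton_apply]
    rw [Lp.simpleFunc.coe_indicatorConst]
    apply Lp.ext
    filter_upwards [ContinuousLinearMap.coeFn_compLp (innerSL ℝ u) (indicatorConstLp 2 hs hμs.ne c),
      Lp.coeFn_smul ((innerSL ℝ c) u) (indicatorConstLp 2 hs hμs.ne (1 : ℝ)),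
      indicatorConstLp_coeFn (p := 2) (hs := hs) (hμs := hμs.ne) (c := c),
      indicatorConstLp_coeFn (p := 2) (hs := hs) (hμs := hμs.ne) (c := (1 : ℝ))] with x h1 h2 h3 h4
    rw [h1, h2, Pi.smul_apply, h3, h4]
    by_cases hx : x ∈ s <;> simp [hx, real_inner_comm]
  · intro f g hf hg _ h1 h2
    rw [map_add]
    exact h1.add h2
  · exact (isClosed_setOfPred_isCompactOperator).preimage
      ((innerSL ℝ : E →L[ℝ] E →L[ℝ] ℝ).compLpL₂ 2 μ).flip.continuous

theorem main_aux_s1 {n : ℕ} (μ : Measure (Fin n → ℝ)) [IsFiniteMeasure μ]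
    (k : (Fin n → ℝ) → ℝ) (hk : UniformContinuous k) (C : ℝ) (hC : ∀ z, ‖k z‖ ≤ C)
    (S : Set (Fin n → ℝ)) (hS : IsCompact S) (hSμ : ∀ᵐ x ∂μ, x ∈ S)
    (T : Lp ℝ 2 μ →L[ℝ] Lp ℝ 2 μ)
    (hT : ∀ u : Lp ℝ 2 μ, (T u : (Fin n → ℝ) → ℝ) =ᵐ[μ]
        fun x => ∫ y, k (x - y) * (u y - u x) ∂μ)
    (lam : ℝ) (hlam : lam ∈ spectrum ℝ T) (hb : ∀ x ∈ S, - ∫ y, k (x - y) ∂μ ≠ lam) :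
    ∃ φ : Lp ℝ 2 μ, φ ≠ 0 ∧ T φ = lam • φ := by
  have hkc : Continuous k := hk.continuous
  have hmem : ∀ x, MemLp (fun y => k (x - y)) 2 μ := fun x =>
    MemLp.of_bound (by fun_prop) C (.of_forall fun y => hC _)
  have hint : ∀ x, Integrable (fun y => k (x - y)) μ := fun x =>
    (hmem x).integrable (by norm_num)
  set G : (Fin n → ℝ) → Lp ℝ 2 μ := fun x => (hmem x).toLp _ with hG
  have hGc : Continuous G := by
    rw [Metric.continuous_iff]
    intro x e he
    set A : ℝ := (measureUnivNNReal μ : ℝ) ^ (2 : ENNReal).toReal⁻¹ with hA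
    have hA0 : 0 ≤ A := by positivity
    obtain ⟨d, hd, h⟩ := Metric.uniformContinuous_iff.1 hk (e / (A + 1)) (by positivity)
    refine ⟨d, hd, fun a ha => ?_⟩
    rw [dist_eq_norm]
    have := Lp.norm_le_of_ae_bound (p := 2) (f := G a - G x) (C := e / (A + 1)) (by positivity) (by
      filter_upwards [Lp.coeFn_sub (G a) (G x), (hmem a).coeFn_toLp, (hmem x).coeFn_toLp]
        with y h1 h2 h3
      rw [h1, Pi.sub_apply, h2, h3, ← dist_eq_norm]
      exact (h (by simpa using ha)).le)
    refine this.trans_lt ?_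
    rw [← hA, mul_div_assoc', div_lt_iff₀ (by positivity)]
    nlinarith
  have hGn : ∀ x, ‖G x‖ ≤ (measureUnivNNReal μ : ℝ) ^ (2 : ENNReal).toReal⁻¹ * C := fun x =>
    Lp.norm_le_of_ae_bound (p := 2) ((norm_nonneg _).trans (hC 0)) (by
      filter_upwards [(hmem x).coeFn_toLp] with y h1
      rw [h1]; exact hC _)
  have hGm : MemLp G 2 μ := MemLp.of_bound hGc.aestronglyMeasurable _ (.of_forall hGn)
  set K : Lp ℝ 2 μ →L[ℝ] Lp ℝ 2 μ :=
    ((innerSL ℝ : Lp ℝ 2 μ →L[ℝ] Lp ℝ 2 μ →L[ℝ] ℝ).compLpL₂ 2 μ).flip (hGm.toLp G) with hK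
  have hKc : IsCompactOperator K := isCompactOperator_hs _
  have hKu : ∀ u : Lp ℝ 2 μ, K u =ᵐ[μ] fun x => ∫ y, k (x - y) * u y ∂μ := by
    intro u
    filter_upwards [ContinuousLinearMap.coeFn_compLp (innerSL ℝ u) (hGm.toLp G),
      hGm.coeFn_toLp] with x h1 h2
    have : K u = (innerSL ℝ u).compLp (hGm.toLp G) := rfl
    rw [this, h1, h2, innerSL_apply_apply, L2.inner_def]
    apply integral_congr_ae
    filter_upwards [(hmem x).coeFn_toLp] with y h3
    rw [h3]
    simp
  -- the multiplier
  set b : (Fin n → ℝ) → ℝ := fun x => - ∫ y, k (x - y) ∂μ with hbdef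
  have hbc : Continuous b := by
    refine (continuous_of_dominated (bound := fun _ => C) (fun x => by fun_prop)
      (fun x => .of_forall fun y => hC _) (integrable_const _) (.of_forall fun y => ?_)).neg
    fun_prop
  have hf0 : ∀ x ∈ S, lam - b x ≠ 0 := fun x hx h => hb x hx (sub_eq_zero.1 h).symm
  obtain ⟨C1, hC1⟩ := hS.exists_bound_of_continuousOn (f := fun x => lam - b x) (by fun_prop)
  obtain ⟨C2, hC2⟩ := hS.exists_bound_of_continuousOn (f := fun x => (lam - b x)⁻¹)
    (ContinuousOn.inv₀ (by fun_prop) hf0)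
  have hm1 : MemLp (fun x => lam - b x) ⊤ μ := memLp_top_of_bound (by fun_prop) C1
    (hSμ.mono hC1)
  have hm2 : MemLp (fun x => (lam - b x)⁻¹) ⊤ μ :=
    memLp_top_of_bound (by
      have : Measurable fun x => (lam - b x)⁻¹ := (hbc.measurable.const_sub lam).inv
      exact this.aestronglyMeasurable) C2
    (hSμ.mono hC2)
  set M : Lp ℝ 2 μ →L[ℝ] Lp ℝ 2 μ :=
    (ContinuousLinearMap.mul ℝ ℝ).holderL μ ⊤ 2 2 (hm1.toLp _) with hM
  set N : Lp ℝ 2 μ →L[ℝ] Lp ℝ 2 μ :=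
    (ContinuousLinearMap.mul ℝ ℝ).holderL μ ⊤ 2 2 (hm2.toLp _) with hN
  have hMu : ∀ u : Lp ℝ 2 μ, M u =ᵐ[μ] fun x => (lam - b x) * u x := by
    intro u
    filter_upwards [(ContinuousLinearMap.mul ℝ ℝ).coeFn_holder (r := 2) (hm1.toLp _) u,
      hm1.coeFn_toLp] with x h1 h2
    rw [hM, ContinuousLinearMap.holderL_apply_apply, h1, h2]
    rfl
  have hNu : ∀ u : Lp ℝ 2 μ, N u =ᵐ[μ] fun x => (lam - b x)⁻¹ * u x := by
    intro u
    filter_upwards [(ContinuousLinearMap.mul ℝ ℝ).coeFn_holder (r := 2) (hm2.toLp _) u,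
      hm2.coeFn_toLp] with x h1 h2
    rw [hN, ContinuousLinearMap.holderL_apply_apply, h1, h2]
    simp
  have hMN : M * N = 1 := by
    ext1 u
    change M (N u) = u
    apply Lp.ext
    filter_upwards [hMu (N u), hNu u, hSμ] with x h1 h2 hx
    rw [h1, h2, mul_inv_cancel_left₀ (hf0 x hx)]
  have hNM : N * M = 1 := by
    ext1 u
    change N (M u) = u
    apply Lp.ext
    filter_upwards [hNu (M u), hMu u, hSμ] with x h1 h2 hx
    rw [h1, h2, inv_mul_cancel_left₀ (hf0 x hx)]
  have hTK : ∀ u, lam • u - T u = M u - K u := by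
    intro u
    apply Lp.ext
    filter_upwards [Lp.coeFn_sub (lam • u) (T u), Lp.coeFn_sub (M u) (K u), Lp.coeFn_smul lam u,
      hT u, hMu u, hKu u] with x h1 h2 h3 h4 h5 h6
    rw [h1, h2, Pi.sub_apply, Pi.sub_apply, h3, h4, h5, h6, Pi.smul_apply]
    have hi : Integrable (fun y => k (x - y) * u y) μ := (hmem x).integrable_mul (Lp.memLp u)
    have : ∫ y, k (x - y) * (u y - u x) ∂μ
        = (∫ y, k (x - y) * u y ∂μ) - (∫ y, k (x - y) ∂μ) * u x := by
      rw [← integral_mul_const, ← integral_sub hi ((hint x).mul_const _)]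
      simp only [mul_sub]
    rw [this, smul_eq_mul, hbdef]
    ring
  have hcomp : IsCompactOperator (N * K : Lp ℝ 2 μ →L[ℝ] Lp ℝ 2 μ) := hKc.clm_comp N
  rcases hcomp.hasEigenvalue_or_mem_resolventSet (μ := (1 : ℝ)) one_ne_zero with h | h
  · obtain ⟨φ, hφ⟩ := h.exists_hasEigenvector
    refine ⟨φ, hφ.2, ?_⟩
    have h1 : N (K φ) = φ := by simpa using hφ.apply_eq_smul
    have h2 : M φ = K φ := by
      have := congrArg (fun L : Lp ℝ 2 μ →L[ℝ] Lp ℝ 2 μ => L (K φ)) hMN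
      change M (N (K φ)) = K φ at this
      rwa [h1] at this
    have h3 := hTK φ
    rw [h2, sub_self] at h3
    exact (sub_eq_zero.1 h3).symm
  · exfalso
    apply hlam
    have h1 : IsUnit (1 - N * K) := by
      have := (spectrum.mem_resolventSet_iff).1 h
      simpa using this
    have h2 : algebraMap ℝ (Lp ℝ 2 μ →L[ℝ] Lp ℝ 2 μ) lam - T = M * (1 - N * K) := by
      rw [mul_sub, ← mul_assoc, hMN, one_mul, mul_one]
      ext1 u
      simpa [Algebra.algebraMap_eq_smul_one] using hTK u
    have hMunit : IsUnit M := ⟨⟨M, N, hMN, hNM⟩, rfl⟩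
    rw [spectrum.mem_resolventSet_iff, h2]
    exact hMunit.mul h1

/-- every element of the spectrum of `𝓛_ε` on `L²(Ω)` outside of the
set `b_ε[Ω̄]` is an eigenvalue of `𝓛_ε`. -/
theorem stmt1 {n : ℕ} (Ω : Set (Fin n → ℝ)) (hΩo : IsOpen Ω)
    (hΩb : Bornology.IsBounded Ω)
    (J : (Fin n → ℝ) → ℝ) (hJc : Continuous J) (hJnn : ∀ z, 0 ≤ J z) (hJ0 : 0 < J 0)
    (hJsymm : ∀ z, J (-z) = J z)
    (hJdec : Tendsto J (cocompact (Fin n → ℝ)) (nhds 0))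
    (hJ2 : Integrable (fun z : Fin n → ℝ => J z * ∑ i, (z i) ^ 2))
    (hJ1 : (∫ z : Fin n → ℝ, J z) = 1)
    (ε m : ℝ) (hε : 0 < ε) (hm : m ∈ Set.Icc (0 : ℝ) 2)
    (T : Lp ℝ 2 (volume.restrict Ω) →L[ℝ] Lp ℝ 2 (volume.restrict Ω))
    (hT : ∀ u : Lp ℝ 2 (volume.restrict Ω),
      (T u : (Fin n → ℝ) → ℝ) =ᵐ[volume.restrict Ω]
        fun x => Lop Ω (Jeps n J ε m) u x) :
    ∀ lam : ℝ, lam ∈ spectrum ℝ T →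
      lam ∉ beps Ω (Jeps n J ε m) '' closure Ω →
      ∃ φ : Lp ℝ 2 (volume.restrict Ω), φ ≠ 0 ∧ T φ = lam • φ := by
  intro lam hlam hb
  haveI : IsFiniteMeasure (volume.restrict Ω) :=
    ⟨by rw [Measure.restrict_apply_univ]; exact hΩb.measure_lt_top⟩
  have hJu : UniformContinuous J := hJc.uniformContinuous_of_tendsto_cocompact hJdec
  obtain ⟨C, hC⟩ : ∃ C, ∀ z, ‖J z‖ ≤ C := by
    let F : ZeroAtInftyContinuousMap (Fin n → ℝ) ℝ := ⟨⟨J, hJc⟩, hJdec⟩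
    exact ⟨‖F.toBCF‖, fun z => F.toBCF.norm_coe_le_norm z⟩
  set c : ℝ := ((2 : ℝ)⁻¹ * ∫ w : Fin n → ℝ, J w * ∑ i, (w i) ^ 2)⁻¹ / ε ^ (m + (n : ℝ)) with hc
  have hk : UniformContinuous (Jeps n J ε m) :=
    (hJu.comp (uniformContinuous_const_smul ε⁻¹)).const_mul' c
  refine main_aux_s1 (volume.restrict Ω) (Jeps n J ε m) hk (‖c‖ * C) (fun z => ?_) (closure Ω)
    hΩb.isCompact_closure ?_ T hT lam hlam ?_
  · change ‖c * J (ε⁻¹ • z)‖ ≤ _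
    rw [norm_mul]
    exact mul_le_mul_of_nonneg_left (hC _) (norm_nonneg _)
  · filter_upwards [ae_restrict_mem hΩo.measurableSet] with x hx using subset_closure hx
  · intro x hx h
    exact hb ⟨x, hx, h⟩
end
end

section
/- Let Ω ⊂ ℝⁿ be open and bounded, let J_ε be the rescaled kernel of the general case, and let f ∈ C¹(ℝ) with f' bounded. Then for every u₀ ∈ L²(Ω) there exists a unique u ∈ C([0,∞), L²(Ω)) such that for all t ≥ 0, u(t) = u₀ + ∫₀ᵗ (𝓛_ε u(s) + f(u(s))) ds in L²(Ω). -/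
open MeasureTheory Real Filter

noncomputable section

/-- Global Picard–Lindelöf for globally Lipschitz autonomous fields. -/
theorem picard_exists {E : Type*} [NormedAddCommGroup E] [NormedSpace ℝ E] [CompleteSpace E]
    (G : E → E) (K : NNReal) (hG : LipschitzWith K G) (u₀ : E) :
    ∃ u : ℝ → E, ContinuousOn u (Set.Ici 0) ∧
      ∀ t ≥ (0 : ℝ), u t = u₀ + ∫ s in (0 : ℝ)..t, G (u s) := by
  set l : ℝ := K + 1 with hl
  have hl0 : 0 < l := by positivity
  have hGc : Continuous G := hG.continuous
  have hint : ∀ t : ℝ, ∫ s in (0:ℝ)..t, Real.exp (l * s) = (Real.exp (l * t) - 1) / l := by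
    intro t
    have : ∀ x ∈ Set.uIcc 0 t, HasDerivAt (fun s => Real.exp (l * s) / l) (Real.exp (l * x)) x := by
      intro x _
      have h1 : HasDerivAt (fun s : ℝ => l * s) l x := by
        simpa using (hasDerivAt_id x).const_mul l
      have := (h1.exp).div_const l
      rwa [mul_div_cancel_right₀ _ hl0.ne'] at this
    rw [intervalIntegral.integral_eq_sub_of_hasDerivAt this
      ((by fun_prop : Continuous fun s : ℝ => Real.exp (l * s)).intervalIntegrable _ _)]
    simp; ring
  -- key estimate
  have key : ∀ (F : ℝ → E) (C : ℝ), 0 ≤ C → (∀ s, 0 ≤ s → ‖F s‖ ≤ C * Real.exp (l * s)) →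
      ∀ t, 0 ≤ t → ‖Real.exp (-(l * t)) • ∫ s in (0:ℝ)..t, F s‖ ≤ C / l := by
    intro F C hC hF t ht
    have h1 : ‖∫ s in (0:ℝ)..t, F s‖ ≤ ∫ s in (0:ℝ)..t, C * Real.exp (l * s) := by
      apply intervalIntegral.norm_integral_le_of_norm_le ht
      · exact Filter.Eventually.of_forall fun s hs => hF s hs.1.le
      · exact (by fun_prop : Continuous fun s : ℝ => C * Real.exp (l * s)).intervalIntegrable _ _
    rw [intervalIntegral.integral_const_mul, hint] at h1
    rw [norm_smul, Real.norm_eq_abs, abs_of_pos (Real.exp_pos _)]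
    calc Real.exp (-(l * t)) * ‖∫ s in (0:ℝ)..t, F s‖
        ≤ Real.exp (-(l * t)) * (C * ((Real.exp (l * t) - 1) / l)) := by gcongr
      _ = C / l * (1 - Real.exp (-(l * t))) := by
          have : Real.exp (-(l * t)) * Real.exp (l * t) = 1 := by
            rw [← Real.exp_add]; simp
          linear_combination C / l * this
      _ ≤ C / l * 1 := by
          gcongr
          linarith [Real.exp_pos (-(l * t))]
      _ = C / l := mul_one _
  have hFc : ∀ w : BoundedContinuousFunction ℝ E,
      Continuous fun s : ℝ => G (Real.exp (l * s) • w s) := fun w => by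
    have := w.continuous
    fun_prop
  have hFi : ∀ (w : BoundedContinuousFunction ℝ E) (a b : ℝ),
      IntervalIntegrable (fun s : ℝ => G (Real.exp (l * s) • w s)) volume a b :=
    fun w a b => (hFc w).intervalIntegrable _ _
  have hΦ : ∀ w : BoundedContinuousFunction ℝ E, ∃ z : BoundedContinuousFunction ℝ E,
      ∀ t, z t = Real.exp (-(l * |t|)) • (u₀ + ∫ s in (0:ℝ)..|t|, G (Real.exp (l * s) • w s)) := by
    intro w
    have hprim : Continuous fun t : ℝ => ∫ s in (0:ℝ)..t, G (Real.exp (l * s) • w s) :=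
      intervalIntegral.continuous_primitive (fun a b => hFi w a b) 0
    have hc : Continuous fun t : ℝ => Real.exp (-(l * |t|)) •
        (u₀ + ∫ s in (0:ℝ)..|t|, G (Real.exp (l * s) • w s)) := by
      have := hprim.comp continuous_abs
      simp only [Function.comp_def] at this
      fun_prop
    refine ⟨BoundedContinuousFunction.ofNormedAddCommGroup _ hc
      (‖u₀‖ + (‖G 0‖ + K * ‖w‖) / l) ?_, fun t => rfl⟩
    intro t
    rw [smul_add]
    refine (norm_add_le _ _).trans (add_le_add ?_ ?_)
    · rw [norm_smul, Real.norm_eq_abs, abs_of_pos (Real.exp_pos _)]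
      have : Real.exp (-(l * |t|)) ≤ 1 := by
        rw [Real.exp_le_one_iff]
        have := abs_nonneg t
        nlinarith
      nlinarith [norm_nonneg u₀]
    · refine key _ _ (by positivity) ?_ _ (abs_nonneg t)
      intro s hs
      have h1 : 1 ≤ Real.exp (l * s) := Real.one_le_exp (by positivity)
      have h2 := hG.norm_sub_le (Real.exp (l * s) • w s) 0
      have h3 : ‖G (Real.exp (l * s) • w s)‖ ≤ ‖G 0‖ + ‖G (Real.exp (l * s) • w s) - G 0‖ :=
        norm_le_norm_add_norm_sub' _ _
      rw [sub_zero, norm_smul, Real.norm_eq_abs, abs_of_pos (Real.exp_pos _)] at h2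
      have h4 := w.norm_coe_le_norm s
      have h5 : (K:ℝ) * (Real.exp (l * s) * ‖w s‖) ≤ K * (Real.exp (l * s) * ‖w‖) := by gcongr
      nlinarith [norm_nonneg (G 0)]
  choose Φ hΦ using hΦ
  have hcontr : ContractingWith (K / (K + 1)) Φ := by
    constructor
    · rw [div_lt_one (by positivity)]
      exact lt_add_one K
    · refine LipschitzWith.of_dist_le_mul fun w z => ?_
      rw [BoundedContinuousFunction.dist_le (by positivity)]
      intro t
      rw [hΦ, hΦ, dist_eq_norm, ← smul_sub, add_sub_add_left_eq_sub,
        ← intervalIntegral.integral_sub (hFi _ _ _) (hFi _ _ _)]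
      have : ((K / (K + 1) : NNReal) : ℝ) * dist w z = K * dist w z / l := by
        rw [hl]; push_cast; ring
      rw [this]
      refine key _ _ (by positivity) ?_ _ (abs_nonneg t)
      intro s hs
      refine (hG.norm_sub_le _ _).trans ?_
      rw [← smul_sub, norm_smul, Real.norm_eq_abs, abs_of_pos (Real.exp_pos _), ← dist_eq_norm]
      have := BoundedContinuousFunction.dist_coe_le_dist (f := w) (g := z) s
      calc (K:ℝ) * (Real.exp (l * s) * dist (w s) (z s))
          ≤ K * (Real.exp (l * s) * dist w z) := by gcongr
        _ = _ := by ring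
  have hfix := hcontr.fixedPoint_isFixedPt
  set w := hcontr.fixedPoint with hw
  refine ⟨fun t => Real.exp (l * t) • w t, ?_, ?_⟩
  · have := w.continuous
    exact (by fun_prop : Continuous fun t : ℝ => Real.exp (l * t) • w t).continuousOn
  · intro t ht
    have h1 : w t = Φ w t := by rw [hfix]
    change Real.exp (l * t) • w t = _
    rw [h1, hΦ, abs_of_nonneg ht, smul_smul, ← Real.exp_add]
    simp

theorem picard_hasDeriv {E : Type*} [NormedAddCommGroup E] [NormedSpace ℝ E] [CompleteSpace E]
    (G : E → E) (hG : Continuous G) (u₀ : E) (u : ℝ → E)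
    (hu : ContinuousOn u (Set.Ici 0))
    (h : ∀ t ≥ (0 : ℝ), u t = u₀ + ∫ s in (0 : ℝ)..t, G (u s)) (t : ℝ) (ht : 0 ≤ t) :
    HasDerivWithinAt u (G (u t)) (Set.Ici t) t := by
  have hc : Continuous fun s : ℝ => u (max s 0) :=
    hu.comp_continuous (by fun_prop) fun s => Set.mem_Ici.2 (le_max_right _ _)
  have hc2 : Continuous fun s : ℝ => G (u (max s 0)) := hG.comp hc
  have h1 : HasDerivAt (fun t => u₀ + ∫ s in (0:ℝ)..t, G (u (max s 0))) (G (u (max t 0))) t :=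
    (intervalIntegral.integral_hasDerivAt_right (hc2.intervalIntegrable _ _)
      (hc2.stronglyMeasurableAtFilter _ _) hc2.continuousAt).const_add u₀
  rw [max_eq_left ht] at h1
  have h2 : ∀ x, 0 ≤ x → u x = u₀ + ∫ s in (0:ℝ)..x, G (u (max s 0)) := by
    intro x hx
    rw [h x hx]
    congr 1
    apply intervalIntegral.integral_congr
    intro s hs
    rw [Set.uIcc_of_le hx] at hs
    simp [max_eq_left hs.1]
  exact h1.hasDerivWithinAt.congr (fun x hx => h2 x (ht.trans hx)) (h2 t ht)

theorem picard_unique {E : Type*} [NormedAddCommGroup E] [NormedSpace ℝ E] [CompleteSpace E]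
    (G : E → E) (K : NNReal) (hG : LipschitzWith K G) (u₀ : E) (u v : ℝ → E)
    (hu : ContinuousOn u (Set.Ici 0) ∧
      ∀ t ≥ (0 : ℝ), u t = u₀ + ∫ s in (0 : ℝ)..t, G (u s))
    (hv : ContinuousOn v (Set.Ici 0) ∧
      ∀ t ≥ (0 : ℝ), v t = u₀ + ∫ s in (0 : ℝ)..t, G (v s)) (t : ℝ) (ht : 0 ≤ t) :
    u t = v t := by
  refine ODE_solution_unique (v := fun _ => G) (K := K) (a := 0) (b := t) (fun _ => hG)
    (hu.1.mono fun x hx => hx.1)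
    (fun x hx => picard_hasDeriv G hG.continuous u₀ u hu.1 hu.2 x hx.1)
    (hv.1.mono fun x hx => hx.1)
    (fun x hx => picard_hasDeriv G hG.continuous u₀ v hv.1 hv.2 x hx.1) ?_ ⟨ht, le_rfl⟩
  rw [hu.2 0 le_rfl, hv.2 0 le_rfl]; simp

/-- existence and uniqueness of the mild solution
`u ∈ C([0,∞), L²(Ω))` of `u(t) = u₀ + ∫₀ᵗ (𝓛_ε u(s) + f(u(s))) ds`.
Here `T` is the dispersion operator `𝓛_ε` on `L²(Ω)` and `N` the Nemytskii
operator of `f`. -/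
theorem stmt8 {n : ℕ} (Ω : Set (Fin n → ℝ)) (hΩo : IsOpen Ω)
    (hΩb : Bornology.IsBounded Ω)
    (J : (Fin n → ℝ) → ℝ) (hJc : Continuous J) (hJnn : ∀ z, 0 ≤ J z) (hJ0 : 0 < J 0)
    (hJsymm : ∀ z, J (-z) = J z)
    (hJdec : Tendsto J (cocompact (Fin n → ℝ)) (nhds 0))
    (hJ2 : Integrable (fun z : Fin n → ℝ => J z * ∑ i, (z i) ^ 2))
    (hJ1 : (∫ z : Fin n → ℝ, J z) = 1)
    (ε m : ℝ) (hε : 0 < ε) (hm : m ∈ Set.Icc (0 : ℝ) 2)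
    (f : ℝ → ℝ) (hf : ContDiff ℝ 1 f) (hf' : ∃ M, ∀ s, |deriv f s| ≤ M)
    (T : Lp ℝ 2 (volume.restrict Ω) →L[ℝ] Lp ℝ 2 (volume.restrict Ω))
    (hT : ∀ u : Lp ℝ 2 (volume.restrict Ω),
      (T u : (Fin n → ℝ) → ℝ) =ᵐ[volume.restrict Ω]
        fun x => Lop Ω (Jeps n J ε m) u x)
    (N : Lp ℝ 2 (volume.restrict Ω) → Lp ℝ 2 (volume.restrict Ω))
    (hN : ∀ v : Lp ℝ 2 (volume.restrict Ω),
      (N v : (Fin n → ℝ) → ℝ) =ᵐ[volume.restrict Ω] fun x => f (v x))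
    (u₀ : Lp ℝ 2 (volume.restrict Ω)) :
    (∃ u : ℝ → Lp ℝ 2 (volume.restrict Ω), ContinuousOn u (Set.Ici 0) ∧
      ∀ t ≥ (0 : ℝ), u t = u₀ + ∫ s in (0 : ℝ)..t, (T (u s) + N (u s))) ∧
    (∀ u v : ℝ → Lp ℝ 2 (volume.restrict Ω),
      (ContinuousOn u (Set.Ici 0) ∧
        ∀ t ≥ (0 : ℝ), u t = u₀ + ∫ s in (0 : ℝ)..t, (T (u s) + N (u s))) →
      (ContinuousOn v (Set.Ici 0) ∧
        ∀ t ≥ (0 : ℝ), v t = u₀ + ∫ s in (0 : ℝ)..t, (T (v s) + N (v s))) →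
      ∀ t ≥ (0 : ℝ), u t = v t) := by
  obtain ⟨M, hM⟩ := hf'
  have hM0 : 0 ≤ M := (abs_nonneg _).trans (hM 0)
  have hfl : LipschitzWith ⟨M, hM0⟩ f :=
    lipschitzWith_of_nnnorm_deriv_le (hf.differentiable (by norm_num)) fun x => hM x
  have hNl : LipschitzWith ⟨M, hM0⟩ N := by
    refine LipschitzWith.of_dist_le_mul fun v w => ?_
    rw [dist_eq_norm, dist_eq_norm]
    refine Lp.norm_le_mul_norm_of_ae_le_mul ?_
    filter_upwards [hN v, hN w, Lp.coeFn_sub (N v) (N w), Lp.coeFn_sub v w] with x h1 h2 h3 h4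
    rw [h3, h4, Pi.sub_apply, Pi.sub_apply, h1, h2]
    exact hfl.norm_sub_le _ _
  have hG : LipschitzWith (‖T‖₊ + ⟨M, hM0⟩) fun u => T u + N u := T.lipschitz.add hNl
  exact ⟨picard_exists _ _ hG u₀, fun u v hu hv t ht => picard_unique _ _ hG u₀ u v hu hv t ht⟩
end
end

section
/- Let Ω ⊂ ℝⁿ be open and bounded, let J_ε be the rescaled kernel of the general case, and let f ∈ C¹(ℝ) with f' bounded. If u₀ ∈ C(Ω̄), then for every T > 0 there exists a unique function u ∈ C(Ω̄ × [0,T]) satisfying u(x,t) = u₀(x) + ∫₀ᵗ 𝓛_ε u(x,s) ds + ∫₀ᵗ f(u(x,s)) ds for all (x,t) ∈ Ω̄ × [0,T]; moreover the time derivative u_t exists and is continuous on Ω̄ × [0,T], and u_t(x,t) = 𝓛_ε u(x,t) + f(u(x,t)). -/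
open MeasureTheory Real Filter

noncomputable section

/-- The right hand side of the evolution equation at a point of space-time. -/
def Gop {n : ℕ} (Ω : Set (Fin n → ℝ)) (K : (Fin n → ℝ) → ℝ) (f : ℝ → ℝ)
    (W : (Fin n → ℝ) × ℝ → ℝ) (p : (Fin n → ℝ) × ℝ) : ℝ :=
  Lop Ω K (fun y => W (y, p.2)) p.1 + f (W p)

lemma Lop_continuous {n : ℕ} (Ω : Set (Fin n → ℝ))
    (hΩb : Bornology.IsBounded Ω) (K : (Fin n → ℝ) → ℝ) (hK : Continuous K)
    (W : (Fin n → ℝ) × ℝ → ℝ) (hW : Continuous W) :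
    Continuous (fun p : (Fin n → ℝ) × ℝ => Lop Ω K (fun y => W (y, p.2)) p.1) := by
  have h := continuous_parametric_integral_of_continuous (μ := volume.restrict Ω)
    (f := fun (p : (Fin n → ℝ) × ℝ) (y : Fin n → ℝ) => K (p.1 - y) * (W (y, p.2) - W p))
    (by unfold Function.uncurry; fun_prop) (hΩb.isCompact_closure)
  rw [Measure.restrict_restrict isClosed_closure.measurableSet,
    Set.inter_eq_right.2 subset_closure] at h
  exact h

lemma Gop_continuous {n : ℕ} (Ω : Set (Fin n → ℝ))
    (hΩb : Bornology.IsBounded Ω) (K : (Fin n → ℝ) → ℝ) (hK : Continuous K)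
    (f : ℝ → ℝ) (hf : Continuous f)
    (W : (Fin n → ℝ) × ℝ → ℝ) (hW : Continuous W) : Continuous (Gop Ω K f W) :=
  (Lop_continuous Ω hΩb K hK W hW).add (hf.comp hW)

lemma Gop_congr {n : ℕ} (Ω : Set (Fin n → ℝ)) (hΩo : IsOpen Ω) (K : (Fin n → ℝ) → ℝ) (f : ℝ → ℝ)
    (W V : (Fin n → ℝ) × ℝ → ℝ) (x : Fin n → ℝ) (hx : x ∈ closure Ω) (s : ℝ)
    (h : ∀ y ∈ closure Ω, W (y, s) = V (y, s)) : Gop Ω K f W (x, s) = Gop Ω K f V (x, s) := by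
  unfold Gop Lop
  simp only
  rw [h x hx]
  congr 1
  refine setIntegral_congr_fun hΩo.measurableSet fun y hy => ?_
  rw [h y (subset_closure hy)]

lemma Gop_lip {n : ℕ} (Ω : Set (Fin n → ℝ)) (hΩo : IsOpen Ω)
    (hΩb : Bornology.IsBounded Ω) (K : (Fin n → ℝ) → ℝ) (hK : Continuous K)
    (f : ℝ → ℝ) (M : ℝ) (hf : ∀ a b, |f a - f b| ≤ M * |a - b|) (hM : 0 ≤ M) :
    ∃ L : ℝ, 0 ≤ L ∧ ∀ (W V : (Fin n → ℝ) × ℝ → ℝ), Continuous W → Continuous V →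
      ∀ x ∈ closure Ω, ∀ s c : ℝ, (∀ y ∈ closure Ω, |W (y, s) - V (y, s)| ≤ c) →
        |Gop Ω K f W (x, s) - Gop Ω K f V (x, s)| ≤ L * c := by
  have hc := hΩb.isCompact_closure
  obtain ⟨B, hB⟩ := ((hc.prod hc).exists_bound_of_continuousOn
    (f := fun p : (Fin n → ℝ) × (Fin n → ℝ) => K (p.1 - p.2)) (by fun_prop))
  have hfin : volume Ω < ⊤ := hΩb.measure_lt_top
  refine ⟨|B| * 2 * volume.real Ω + M, by positivity, ?_⟩
  intro W V hW hV x hx s c h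
  have hint : ∀ U : (Fin n → ℝ) × ℝ → ℝ, Continuous U →
      IntegrableOn (fun y => K (x - y) * (U (y, s) - U (x, s))) Ω := fun U hU =>
    ((Continuous.continuousOn (by fun_prop)).integrableOn_compact hc).mono_set subset_closure
  have hc0 : 0 ≤ c := (abs_nonneg _).trans (h x hx)
  have e : Gop Ω K f W (x, s) - Gop Ω K f V (x, s)
      = (∫ y in Ω, (K (x - y) * (W (y, s) - W (x, s)) - K (x - y) * (V (y, s) - V (x, s))))
        + (f (W (x, s)) - f (V (x, s))) := by
    rw [integral_sub (hint W hW) (hint V hV)]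
    unfold Gop Lop
    ring
  rw [e]
  have h1 : ‖∫ y in Ω, (K (x - y) * (W (y, s) - W (x, s)) - K (x - y) * (V (y, s) - V (x, s)))‖
      ≤ (|B| * (2 * c)) * volume.real Ω := by
    refine norm_setIntegral_le_of_norm_le_const hfin fun y hy => ?_
    have hy' := subset_closure hy
    have e2 : K (x - y) * (W (y, s) - W (x, s)) - K (x - y) * (V (y, s) - V (x, s))
      = K (x - y) * ((W (y, s) - V (y, s)) - (W (x, s) - V (x, s))) := by ring
    rw [e2, norm_mul]
    have h3 : ‖K (x - y)‖ ≤ |B| := (hB (x, y) ⟨hx, hy'⟩).trans (le_abs_self _)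
    have h4 : ‖(W (y, s) - V (y, s)) - (W (x, s) - V (x, s))‖ ≤ 2 * c := by
      refine (norm_sub_le _ _).trans ?_
      have := h y hy'
      have := h x hx
      simp only [Real.norm_eq_abs]
      linarith
    gcongr
  have h2 : |f (W (x, s)) - f (V (x, s))| ≤ M * c :=
    (hf _ _).trans (mul_le_mul_of_nonneg_left (h x hx) hM)
  refine (abs_add_le _ _).trans ?_
  rw [Real.norm_eq_abs] at h1
  linarith

theorem main_aux_s10 {n : ℕ} (Ω : Set (Fin n → ℝ)) (hΩo : IsOpen Ω)
    (hΩb : Bornology.IsBounded Ω)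
    (K : (Fin n → ℝ) → ℝ) (hK : Continuous K)
    (f : ℝ → ℝ) (hfc : Continuous f) (M : ℝ) (hM : 0 ≤ M)
    (hf : ∀ a b, |f a - f b| ≤ M * |a - b|)
    (u₀ : (Fin n → ℝ) → ℝ) (hu₀ : ContinuousOn u₀ (closure Ω))
    (Tf : ℝ) :
    ∃ W : (Fin n → ℝ) × ℝ → ℝ, Continuous W ∧
      (∀ x ∈ closure Ω, ∀ t ∈ Set.Icc (0 : ℝ) Tf,
        W (x, t) = u₀ x + ∫ s in (0 : ℝ)..t, Gop Ω K f W (x, s)) ∧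
      (∀ V : (Fin n → ℝ) × ℝ → ℝ, Continuous V →
        (∀ x ∈ closure Ω, ∀ t ∈ Set.Icc (0 : ℝ) Tf,
          V (x, t) = u₀ x + ∫ s in (0 : ℝ)..t, Gop Ω K f V (x, s)) →
        ∀ x ∈ closure Ω, ∀ t ∈ Set.Icc (0 : ℝ) Tf, V (x, t) = W (x, t)) := by
  obtain ⟨L, hL0, hL⟩ := Gop_lip Ω hΩo hΩb K hK f M hf hM
  set S : Set ((Fin n → ℝ) × ℝ) := closure Ω ×ˢ Set.Icc (0:ℝ) Tf with hS
  have hScomp : IsCompact S := hΩb.isCompact_closure.prod isCompact_Icc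
  have : CompactSpace S := isCompact_iff_compactSpace.1 hScomp
  obtain ⟨U0, hU0⟩ := ContinuousMap.exists_restrict_eq (isClosed_closure (s := Ω))
    (⟨_, hu₀.restrict⟩ : C(closure Ω, ℝ))
  have hU0' : ∀ x ∈ closure Ω, U0 x = u₀ x := fun x hx =>
    congrArg (fun g : C(closure Ω, ℝ) => g ⟨x, hx⟩) hU0
  choose ext hext using fun w : C(S, ℝ) => ContinuousMap.exists_restrict_eq hScomp.isClosed w
  have hext' : ∀ w : C(S, ℝ), ∀ p : S, ext w p = w p := fun w p =>
    congrArg (fun g : C(S, ℝ) => g p) (hext w)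
  have hGc : ∀ W : (Fin n → ℝ) × ℝ → ℝ, Continuous W → Continuous (Gop Ω K f W) := fun W hW =>
    Gop_continuous Ω hΩb K hK f hfc W hW
  have hcont : ∀ W : (Fin n → ℝ) × ℝ → ℝ, Continuous W → Continuous
      (fun p : (Fin n → ℝ) × ℝ => U0 p.1 + ∫ s in (0:ℝ)..p.2, Gop Ω K f W (p.1, s)) := by
    intro W hW
    have := hGc W hW
    refine (by fun_prop : Continuous fun p : (Fin n → ℝ) × ℝ => U0 p.1).add ?_
    refine intervalIntegral.continuous_parametric_intervalIntegral_of_continuous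
      (f := fun (p : (Fin n → ℝ) × ℝ) s => Gop Ω K f W (p.1, s)) ?_ continuous_snd
    unfold Function.uncurry
    fun_prop
  let Φ : C(S, ℝ) → C(S, ℝ) := fun w =>
    ⟨fun p => U0 p.1.1 + ∫ s in (0:ℝ)..p.1.2, Gop Ω K f (ext w) (p.1.1, s),
      (hcont (ext w) (ext w).continuous).comp continuous_subtype_val⟩
  have hΦ : ∀ w p, Φ w p = U0 p.1.1 + ∫ s in (0:ℝ)..p.1.2, Gop Ω K f (ext w) (p.1.1, s) :=
    fun _ _ => rfl
  have hiter : ∀ (k : ℕ) (w v : C(S, ℝ)) (p : S),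
      |(Φ^[k] w) p - (Φ^[k] v) p| ≤ dist w v * (L ^ k * p.1.2 ^ k / (k.factorial : ℝ)) := by
    intro k w v
    induction k with
    | zero =>
      intro p
      simpa [Real.dist_eq] using ContinuousMap.dist_apply_le_dist (f := w) (g := v) p
    | succ k ih =>
      rintro ⟨⟨x, t⟩, hx, ht⟩
      simp only [Function.iterate_succ_apply', hΦ]
      simp only at hx ht
      set a := Φ^[k] w
      set b := Φ^[k] v
      have hca := hGc _ (ext a).continuous
      have hcb := hGc _ (ext b).continuous
      rw [add_sub_add_left_eq_sub, ← intervalIntegral.integral_sub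
        (Continuous.intervalIntegrable (by fun_prop) _ _)
        (Continuous.intervalIntegrable (by fun_prop) _ _)]
      have hb : ∀ s ∈ Set.Icc 0 t, ‖Gop Ω K f (ext a) (x, s) - Gop Ω K f (ext b) (x, s)‖
          ≤ dist w v * (L ^ (k+1) / (k.factorial : ℝ)) * s ^ k := by
        intro s hs
        refine (hL _ _ (ext a).continuous (ext b).continuous x hx s
          (dist w v * (L ^ k * s ^ k / (k.factorial : ℝ))) ?_).trans (le_of_eq ?_)
        · intro y hy
          have hm : (y, s) ∈ S := ⟨hy, hs.1, hs.2.trans ht.2⟩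
          have := ih ⟨(y, s), hm⟩
          rwa [← hext' a, ← hext' b] at this
        · ring
      have := intervalIntegral.norm_integral_le_of_norm_le (μ := volume) ht.1
        (g := fun s => dist w v * (L ^ (k+1) / (k.factorial : ℝ)) * s ^ k)
        (Filter.Eventually.of_forall fun s hs => hb s ⟨hs.1.le, hs.2⟩)
        (Continuous.intervalIntegrable (by fun_prop) _ _)
      refine this.trans (le_of_eq ?_)
      rw [intervalIntegral.integral_const_mul, integral_pow, Nat.factorial_succ]
      push_cast
      have : (k.factorial : ℝ) ≠ 0 := by positivity
      have : (k : ℝ) + 1 ≠ 0 := by positivity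
      field_simp
      ring
  obtain ⟨k, hk⟩ : ∃ k : ℕ, (L * |Tf|) ^ k / (k.factorial : ℝ) < 1 / 2 :=
    ((FloorSemiring.tendsto_pow_div_factorial_atTop (L * |Tf|)).eventually
      (gt_mem_nhds (by norm_num : (0:ℝ) < 1/2))).exists
  have hcontr : ContractingWith (1/2) (Φ^[k]) := by
    refine ⟨?_, LipschitzWith.of_dist_le_mul fun w v => ?_⟩
    · rw [← NNReal.coe_lt_coe]; norm_num
    · rw [ContinuousMap.dist_le (by positivity)]
      intro p
      rw [Real.dist_eq]
      refine (hiter k w v p).trans ?_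
      rw [mul_comm]
      refine mul_le_mul_of_nonneg_right ?_ dist_nonneg
      have ht := p.2.2
      have : L ^ k * p.1.2 ^ k ≤ (L * |Tf|) ^ k := by
        rw [← mul_pow]
        have h0 := ht.1
        have h1 := ht.2.trans (le_abs_self _)
        gcongr
      have h2 : L ^ k * p.1.2 ^ k / (k.factorial : ℝ) ≤ (L * |Tf|) ^ k / (k.factorial : ℝ) := by
        gcongr
      push_cast
      linarith
  obtain ⟨w, hw, -⟩ : ∃ w, Φ w = w ∧ True :=
    ⟨_, hcontr.isFixedPt_fixedPoint_iterate, trivial⟩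
  have hfix : ∀ v, Φ v = v → v = w := fun v hv =>
    hcontr.fixedPoint_unique' (Function.IsFixedPt.iterate hv k) (Function.IsFixedPt.iterate hw k)
  refine ⟨ext w, (ext w).continuous, ?_, ?_⟩
  · intro x hx t ht
    have h1 := hext' w ⟨(x, t), hx, ht⟩
    rw [← hw, hΦ, hw, hU0' _ hx] at h1
    exact h1
  · intro V hV hVe x hx t ht
    let v : C(S, ℝ) := ⟨fun p => V p, hV.comp continuous_subtype_val⟩
    have hv : Φ v = v := by
      ext ⟨⟨y, r⟩, hy, hr⟩
      simp only at hy hr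
      rw [hΦ]
      change _ = V (y, r)
      rw [hVe y hy r hr]
      simp only
      rw [hU0' _ hy]
      congr 1
      refine intervalIntegral.integral_congr fun s hs => ?_
      rw [Set.uIcc_of_le hr.1] at hs
      exact Gop_congr Ω hΩo K f _ _ y hy s fun z hz =>
        hext' v ⟨(z, s), hz, hs.1, hs.2.trans hr.2⟩
    have := hext' w ⟨(x, t), hx, ht⟩
    rw [this, ← hfix v hv]
    rfl

/-- for continuous initial data `u₀ ∈ C(Ω̄)` there exists a unique
`u ∈ C(Ω̄ × [0,T])` solving the Duhamel formula; moreover `u` is continuously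
differentiable in time with `u_t = 𝓛_ε u + f(u)`. -/
theorem stmt10 {n : ℕ} (Ω : Set (Fin n → ℝ)) (hΩo : IsOpen Ω)
    (hΩb : Bornology.IsBounded Ω)
    (J : (Fin n → ℝ) → ℝ) (hJc : Continuous J) (hJnn : ∀ z, 0 ≤ J z) (hJ0 : 0 < J 0)
    (hJsymm : ∀ z, J (-z) = J z)
    (hJdec : Tendsto J (cocompact (Fin n → ℝ)) (nhds 0))
    (hJ2 : Integrable (fun z : Fin n → ℝ => J z * ∑ i, (z i) ^ 2))
    (hJ1 : (∫ z : Fin n → ℝ, J z) = 1)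
    (ε m : ℝ) (hε : 0 < ε) (hm : m ∈ Set.Icc (0 : ℝ) 2)
    (f : ℝ → ℝ) (hf : ContDiff ℝ 1 f) (hf' : ∃ M, ∀ s, |deriv f s| ≤ M)
    (u₀ : (Fin n → ℝ) → ℝ) (hu₀ : ContinuousOn u₀ (closure Ω))
    (Tf : ℝ) (hTf : 0 < Tf) :
    ∃ u : (Fin n → ℝ) → ℝ → ℝ,
      (ContinuousOn (fun p : (Fin n → ℝ) × ℝ => u p.1 p.2)
        (closure Ω ×ˢ Set.Icc 0 Tf)) ∧
      (∀ x ∈ closure Ω, ∀ t ∈ Set.Icc (0 : ℝ) Tf,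
        u x t = u₀ x + (∫ s in (0 : ℝ)..t, Lop Ω (Jeps n J ε m) (fun y => u y s) x)
          + ∫ s in (0 : ℝ)..t, f (u x s)) ∧
      (∀ x ∈ closure Ω, ∀ t ∈ Set.Icc (0 : ℝ) Tf,
        HasDerivWithinAt (u x)
          (Lop Ω (Jeps n J ε m) (fun y => u y t) x + f (u x t)) (Set.Icc 0 Tf) t) ∧
      (ContinuousOn (fun p : (Fin n → ℝ) × ℝ =>
          Lop Ω (Jeps n J ε m) (fun y => u y p.2) p.1 + f (u p.1 p.2))
        (closure Ω ×ˢ Set.Icc 0 Tf)) ∧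
      (∀ v : (Fin n → ℝ) → ℝ → ℝ,
        ContinuousOn (fun p : (Fin n → ℝ) × ℝ => v p.1 p.2)
          (closure Ω ×ˢ Set.Icc 0 Tf) →
        (∀ x ∈ closure Ω, ∀ t ∈ Set.Icc (0 : ℝ) Tf,
          v x t = u₀ x + (∫ s in (0 : ℝ)..t, Lop Ω (Jeps n J ε m) (fun y => v y s) x)
            + ∫ s in (0 : ℝ)..t, f (v x s)) →
        ∀ x ∈ closure Ω, ∀ t ∈ Set.Icc (0 : ℝ) Tf, v x t = u x t) := by
  obtain ⟨M, hM⟩ := hf'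
  have hM0 : 0 ≤ M := (abs_nonneg _).trans (hM 0)
  have hfd : Differentiable ℝ f := hf.differentiable (by norm_num)
  have hlip : ∀ a b, |f a - f b| ≤ M * |a - b| := fun a b =>
    Convex.norm_image_sub_le_of_norm_deriv_le (fun x _ => hfd x) (fun x _ => hM x)
      convex_univ (Set.mem_univ b) (Set.mem_univ a)
  have hfc := hf.continuous
  have hK : Continuous (Jeps n J ε m) := by unfold Jeps; fun_prop
  set K := Jeps n J ε m
  obtain ⟨W, hWc, hWe, hWu⟩ := main_aux_s10 Ω hΩo hΩb K hK f hfc M hM0 hlip u₀ hu₀ Tf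
  have hsplit : ∀ V : (Fin n → ℝ) × ℝ → ℝ, Continuous V → ∀ x t,
      ∫ s in (0 : ℝ)..t, Gop Ω K f V (x, s)
        = (∫ s in (0 : ℝ)..t, Lop Ω K (fun y => V (y, s)) x) + ∫ s in (0 : ℝ)..t, f (V (x, s)) := by
    intro V hV x t
    have h1 := (Lop_continuous Ω hΩb K hK V hV).comp (Continuous.prodMk_right x)
    exact intervalIntegral.integral_add (Continuous.intervalIntegrable h1 _ _)
      (Continuous.intervalIntegrable (by fun_prop) _ _)
  have hGc := Gop_continuous Ω hΩb K hK f hfc W hWc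
  refine ⟨fun x t => W (x, t), hWc.continuousOn, ?_, ?_, hGc.continuousOn, ?_⟩
  · intro x hx t ht
    rw [add_assoc, ← hsplit W hWc x t]
    exact hWe x hx t ht
  · intro x hx t ht
    have hc : Continuous fun s => Gop Ω K f W (x, s) := by fun_prop
    have hd : HasDerivAt (fun t => u₀ x + ∫ s in (0 : ℝ)..t, Gop Ω K f W (x, s))
        (Gop Ω K f W (x, t)) t := (hc.integral_hasStrictDerivAt 0 t).hasDerivAt.const_add _
    exact hd.hasDerivWithinAt.congr (fun s hs => hWe x hx s hs) (hWe x hx t ht)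
  · intro v hv hve x hx t ht
    obtain ⟨V, hV⟩ := ContinuousMap.exists_restrict_eq
      (isClosed_closure.prod isClosed_Icc : IsClosed (closure Ω ×ˢ Set.Icc (0:ℝ) Tf))
      (⟨_, hv.restrict⟩ : C(↥(closure Ω ×ˢ Set.Icc (0:ℝ) Tf), ℝ))
    have hV' : ∀ x ∈ closure Ω, ∀ t ∈ Set.Icc (0:ℝ) Tf, V (x, t) = v x t := fun x hx t ht =>
      congrArg (fun g : C(↥(closure Ω ×ˢ Set.Icc (0:ℝ) Tf), ℝ) => g ⟨(x, t), hx, ht⟩) hV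
    rw [← hV' x hx t ht]
    refine hWu V V.continuous ?_ x hx t ht
    intro x hx t ht
    rw [hV' x hx t ht, hve x hx t ht, hsplit V V.continuous x t, add_assoc]
    congr 2
    · refine intervalIntegral.integral_congr fun s hs => ?_
      rw [Set.uIcc_of_le ht.1] at hs
      have hs' : s ∈ Set.Icc (0:ℝ) Tf := ⟨hs.1, hs.2.trans ht.2⟩
      refine setIntegral_congr_fun hΩo.measurableSet fun y hy => ?_
      simp only
      rw [hV' x hx s hs', hV' y (subset_closure hy) s hs']
    · refine intervalIntegral.integral_congr fun s hs => ?_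
      rw [Set.uIcc_of_le ht.1] at hs
      have hs' : s ∈ Set.Icc (0:ℝ) Tf := ⟨hs.1, hs.2.trans ht.2⟩
      rw [hV' x hx s hs']
end
end

section
/- Let Ω ⊂ ℝⁿ be open and bounded, let J_ε be the rescaled kernel of the general case, and let f ∈ C¹(ℝ) with f' bounded and with two zeros u₁ < u₂, f(u₁) = f(u₂) = 0. Let u ∈ C(Ω̄ × [0,T]) with u_t continuous on Ω̄ × [0,T] solve u_t(x,t) = 𝓛_ε u(x,t) + f(u(x,t)) with u(·,0) = u₀ ∈ C(Ω̄). If u₁ ≤ u₀(x) ≤ u₂ for all x ∈ Ω̄, then u₁ ≤ min_{x∈Ω̄} u(x,t) ≤ max_{x∈Ω̄} u(x,t) ≤ u₂ for all t ∈ [0,T]. -/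
open MeasureTheory Real Filter

noncomputable section

/-- Abstract maximum principle on a compact set. -/
theorem aux_max {X : Type*} [TopologicalSpace X] (C : Set X) (hC : IsCompact C) (M T : ℝ)
    (v D : X → ℝ → ℝ)
    (hv : ContinuousOn (fun p : X × ℝ => v p.1 p.2) (C ×ˢ Set.Icc 0 T))
    (hD : ∀ x ∈ C, ∀ t ∈ Set.Icc (0 : ℝ) T, HasDerivWithinAt (v x) (D x t) (Set.Icc 0 T) t)
    (hle : ∀ x ∈ C, ∀ t ∈ Set.Icc (0 : ℝ) T, 0 < v x t → (∀ y ∈ C, v y t ≤ v x t) →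
      D x t ≤ M * v x t)
    (h0 : ∀ x ∈ C, v x 0 ≤ 0) :
    ∀ t ∈ Set.Icc (0 : ℝ) T, ∀ x ∈ C, v x t ≤ 0 := by
  intro t ht x hx
  by_contra hcon
  push Not at hcon
  obtain ⟨⟨a, s⟩, ⟨ha, hs⟩, hmax⟩ := (hC.prod isCompact_Icc).exists_isMaxOn
    (f := fun p : X × ℝ => Real.exp (-(M + 1) * p.2) * v p.1 p.2)
    ⟨(x, t), hx, ht⟩ (ContinuousOn.mul (by fun_prop) hv)
  simp only at ha hs
  have hm : ∀ y ∈ C, ∀ r ∈ Set.Icc (0 : ℝ) T,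
      Real.exp (-(M + 1) * r) * v y r ≤ Real.exp (-(M + 1) * s) * v a s :=
    fun y hy r hr => hmax (Set.mk_mem_prod hy hr)
  have hpos : 0 < v a s := by
    have h1 := hm x hx t ht
    have h2 : 0 < Real.exp (-(M + 1) * t) * v x t := by positivity
    exact pos_of_mul_pos_right (h2.trans_le h1) (Real.exp_pos _).le
  have hs0 : 0 < s := by
    rcases hs.1.eq_or_lt with h | h
    · subst h
      exact absurd hpos (not_lt.2 (h0 a ha))
    · exact h
  have hDle := hle a ha s hs hpos (fun y hy =>
    le_of_mul_le_mul_left (hm y hy s hs) (Real.exp_pos _))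
  have hexp : HasDerivWithinAt (fun r : ℝ => Real.exp (-(M + 1) * r))
      (Real.exp (-(M + 1) * s) * (-(M + 1))) (Set.Icc 0 T) s := by
    have : HasDerivAt (fun r : ℝ => -(M + 1) * r) (-(M + 1)) s := by
      simpa using (hasDerivAt_id s).const_mul (-(M + 1))
    exact this.exp.hasDerivWithinAt
  have hder := hexp.mul (hD a ha s hs)
  have hloc : IsLocalMaxOn ((fun r : ℝ => Real.exp (-(M + 1) * r)) * v a) (Set.Icc 0 T) s :=
    IsMaxOn.localize (fun r hr => hm a ha r hr)
  have hcone : (0 - s) ∈ posTangentConeAt (Set.Icc 0 T) s :=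
    sub_mem_posTangentConeAt_of_segment_subset
      ((convex_Icc 0 T).segment_subset hs ⟨le_rfl, hs.1.trans hs.2⟩)
  have h := hloc.hasFDerivWithinAt_nonpos hder.hasFDerivWithinAt hcone
  simp at h
  have hE := Real.exp_pos (-(M + 1) * s)
  have h3 : Real.exp (-(M + 1) * s) * (-(M + 1)) * v a s + Real.exp (-(M + 1) * s) * D a s < 0 := by
    have : Real.exp (-(M + 1) * s) * (D a s - (M + 1) * v a s) < 0 :=
      mul_neg_of_pos_of_neg hE (by nlinarith)
    linarith
  have h4 := mul_neg_of_pos_of_neg hs0 h3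
  ring_nf at h h4
  linarith

theorem Jeps_nonneg' (n : ℕ) (J : (Fin n → ℝ) → ℝ) (hJnn : ∀ z, 0 ≤ J z) (ε m : ℝ) (hε : 0 < ε)
    (z : Fin n → ℝ) : 0 ≤ Jeps n J ε m z := by
  unfold Jeps
  have h : 0 ≤ ∫ w : Fin n → ℝ, J w * ∑ i, (w i) ^ 2 :=
    integral_nonneg fun w => mul_nonneg (hJnn w) (Finset.sum_nonneg fun i _ => sq_nonneg _)
  have := hJnn (ε⁻¹ • z)
  positivity

/-- invariant region for continuous solutions: if the initial datum
takes values in `[u₁, u₂]` where `u₁ < u₂` are zeros of `f`, then the solution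
stays in `[u₁, u₂]` on `Ω̄ × [0,T]`. -/
theorem stmt12 {n : ℕ} (Ω : Set (Fin n → ℝ)) (hΩo : IsOpen Ω)
    (hΩb : Bornology.IsBounded Ω)
    (J : (Fin n → ℝ) → ℝ) (hJc : Continuous J) (hJnn : ∀ z, 0 ≤ J z) (hJ0 : 0 < J 0)
    (hJsymm : ∀ z, J (-z) = J z)
    (hJdec : Tendsto J (cocompact (Fin n → ℝ)) (nhds 0))
    (hJ2 : Integrable (fun z : Fin n → ℝ => J z * ∑ i, (z i) ^ 2))
    (hJ1 : (∫ z : Fin n → ℝ, J z) = 1)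
    (ε m : ℝ) (hε : 0 < ε) (hm : m ∈ Set.Icc (0 : ℝ) 2)
    (f : ℝ → ℝ) (hf : ContDiff ℝ 1 f) (hf' : ∃ M, ∀ s, |deriv f s| ≤ M)
    (u₁ u₂ : ℝ) (h12 : u₁ < u₂) (hz1 : f u₁ = 0) (hz2 : f u₂ = 0)
    (Tf : ℝ) (hTf : 0 < Tf)
    (u : (Fin n → ℝ) → ℝ → ℝ)
    (hu : ContinuousOn (fun p : (Fin n → ℝ) × ℝ => u p.1 p.2)
      (closure Ω ×ˢ Set.Icc 0 Tf))
    (hueq : ∀ x ∈ closure Ω, ∀ t ∈ Set.Icc (0 : ℝ) Tf,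
      HasDerivWithinAt (u x)
        (Lop Ω (Jeps n J ε m) (fun y => u y t) x + f (u x t)) (Set.Icc 0 Tf) t)
    (hutc : ContinuousOn (fun p : (Fin n → ℝ) × ℝ =>
        Lop Ω (Jeps n J ε m) (fun y => u y p.2) p.1 + f (u p.1 p.2))
      (closure Ω ×ˢ Set.Icc 0 Tf))
    (u₀ : (Fin n → ℝ) → ℝ) (hu₀c : ContinuousOn u₀ (closure Ω))
    (hinit : ∀ x ∈ closure Ω, u x 0 = u₀ x)
    (hrange : ∀ x ∈ closure Ω, u₁ ≤ u₀ x ∧ u₀ x ≤ u₂) :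
    ∀ t ∈ Set.Icc (0 : ℝ) Tf, ∀ x ∈ closure Ω, u₁ ≤ u x t ∧ u x t ≤ u₂ := by
  obtain ⟨M, hM⟩ := hf'
  have hlip : ∀ a b, |f a - f b| ≤ M * |a - b| := fun a b =>
    convex_univ.norm_image_sub_le_of_norm_deriv_le (f := f) (C := M)
      (fun x _ => (hf.differentiable one_ne_zero) x) (fun x _ => hM x)
      (Set.mem_univ b) (Set.mem_univ a)
  have hK := Jeps_nonneg' n J hJnn ε m hε
  have hC : IsCompact (closure Ω) := hΩb.isCompact_closure
  have up := aux_max (closure Ω) hC M Tf (fun x t => u x t - u₂) _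
    (hu.sub continuousOn_const) (fun x hx t ht => (hueq x hx t ht).sub_const u₂)
    (by
      intro x hx t ht hpos hle
      have h1 : Lop Ω (Jeps n J ε m) (fun y => u y t) x ≤ 0 :=
        setIntegral_nonpos hΩo.measurableSet fun y hy =>
          mul_nonpos_of_nonneg_of_nonpos (hK _) (by linarith [hle y (subset_closure hy)])
      have h2 := (le_abs_self _).trans (hlip (u x t) u₂)
      rw [abs_of_pos hpos, hz2] at h2
      linarith)
    (fun x hx => by
      have := (hrange x hx).2
      rw [← hinit x hx] at this
      linarith)
  have lo := aux_max (closure Ω) hC M Tf (fun x t => u₁ - u x t) _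
    (continuousOn_const.sub hu) (fun x hx t ht => (hueq x hx t ht).const_sub u₁)
    (by
      intro x hx t ht hpos hle
      have h1 : 0 ≤ Lop Ω (Jeps n J ε m) (fun y => u y t) x :=
        setIntegral_nonneg hΩo.measurableSet fun y hy =>
          mul_nonneg (hK _) (by linarith [hle y (subset_closure hy)])
      have h2 := (le_abs_self _).trans (hlip u₁ (u x t))
      rw [abs_of_pos hpos, hz1] at h2
      linarith)
    (fun x hx => by
      have := (hrange x hx).1
      rw [← hinit x hx] at this
      linarith)
  intro t ht x hx
  exact ⟨by linarith [lo t ht x hx], by linarith [up t ht x hx]⟩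
end
end

section
/- Let Ω ⊂ ℝⁿ be open and bounded, let J_ε be the rescaled kernel of the general case, and let f ∈ C¹(ℝ) with f' bounded and with two zeros u₁ < u₂, f(u₁) = f(u₂) = 0. Let u ∈ C([0,∞), L²(Ω)) be the solution of u(t) = u₀ + ∫₀ᵗ (𝓛_ε u(s) + f(u(s))) ds with u₀ ∈ L²(Ω). If u₁ ≤ u₀(x) ≤ u₂ for almost every x ∈ Ω, then for every t > 0 one has u₁ ≤ u(x,t) ≤ u₂ for almost every x ∈ Ω; i.e. the interval Γ = [u₁, u₂] is an invariant region. -/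
open MeasureTheory Real Filter

noncomputable section

section Helpers

variable {X : Type*} [MeasurableSpace X] {μ : Measure X}

lemma posPart_taylor (x h : Lp ℝ 2 μ) :
    |‖Lp.posPart (x + h)‖ ^ 2 - ‖Lp.posPart x‖ ^ 2 - 2 * inner ℝ (Lp.posPart x) h| ≤ ‖h‖ ^ 2 := by
  have e : ∀ v : Lp ℝ 2 μ, ‖v‖ ^ 2 = inner ℝ v v := fun v => (real_inner_self_eq_norm_sq v).symm
  rw [e, e, e]
  simp only [L2.inner_def]
  have i1 := L2.integrable_inner (𝕜 := ℝ) (Lp.posPart (x + h)) (Lp.posPart (x + h))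
  have i2 := L2.integrable_inner (𝕜 := ℝ) (Lp.posPart x) (Lp.posPart x)
  have i3 := L2.integrable_inner (𝕜 := ℝ) (Lp.posPart x) h
  have i4 := L2.integrable_inner (𝕜 := ℝ) h h
  rw [← integral_const_mul, ← integral_sub i1 i2]
  have i5 := integral_sub (i1.sub i2) (i3.const_mul 2)
  simp only [Pi.sub_apply] at i5
  rw [← i5, ← Real.norm_eq_abs]
  refine norm_integral_le_of_norm_le i4 ?_
  filter_upwards [Lp.coeFn_posPart (x + h), Lp.coeFn_posPart x, Lp.coeFn_add x h] with a h1 h2 h3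
  simp only [h1, h2, h3, Pi.add_apply, real_inner_eq_re_inner, RCLike.inner_apply,
    conj_trivial, RCLike.re_to_real, Real.norm_eq_abs]
  generalize x a = p
  generalize h a = q
  rw [abs_le]
  rcases max_cases (p + q) 0 with ⟨e1, e2⟩ | ⟨e1, e2⟩ <;>
  rcases max_cases p 0 with ⟨e3, e4⟩ | ⟨e3, e4⟩ <;> rw [e1, e3] <;> constructor <;> nlinarith

lemma posPart_hasFDerivAt (x : Lp ℝ 2 μ) :
    HasFDerivAt (fun y : Lp ℝ 2 μ => ‖Lp.posPart y‖ ^ 2)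
      ((2 : ℝ) • innerSL ℝ (Lp.posPart x)) x := by
  rw [hasFDerivAt_iff_isLittleO_nhds_zero]
  refine Asymptotics.IsBigO.trans_isLittleO (g := fun h : Lp ℝ 2 μ => ‖h‖ ^ 2) ?_ ?_
  · refine Asymptotics.IsBigO.of_bound 1 (Eventually.of_forall fun h => ?_)
    have := posPart_taylor x h
    simpa using this
  · exact Asymptotics.isLittleO_norm_pow_id one_lt_two

lemma upper_bound [IsFiniteMeasure μ] (f : ℝ → ℝ) (M : ℝ)
    (hL : ∀ a b, |f a - f b| ≤ M * |a - b|) (c : ℝ) (hc : f c = 0)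
    (T : Lp ℝ 2 μ →L[ℝ] Lp ℝ 2 μ)
    (hT : ∀ v : Lp ℝ 2 μ, inner ℝ (Lp.posPart (v - Lp.const 2 μ c)) (T v) ≤
      inner ℝ (Lp.posPart (v - Lp.const 2 μ c)) (T (Lp.posPart (v - Lp.const 2 μ c))))
    (N : Lp ℝ 2 μ → Lp ℝ 2 μ) (hN : ∀ v : Lp ℝ 2 μ, (N v : X → ℝ) =ᵐ[μ] fun x => f (v x))
    (u₀ : Lp ℝ 2 μ) (u : ℝ → Lp ℝ 2 μ) (hu : ContinuousOn u (Set.Ici 0))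
    (hueq : ∀ t ≥ (0 : ℝ), u t = u₀ + ∫ s in (0 : ℝ)..t, (T (u s) + N (u s)))
    (hinit : ∀ᵐ x ∂μ, (u₀ : X → ℝ) x ≤ c) :
    ∀ t > (0 : ℝ), ∀ᵐ x ∂μ, (u t : X → ℝ) x ≤ c := by
  have hNl : ∀ v w, ‖N v - N w‖ ≤ M * ‖v - w‖ := by
    intro v w
    refine Lp.norm_le_mul_norm_of_ae_le_mul ?_
    filter_upwards [hN v, hN w, Lp.coeFn_sub v w, Lp.coeFn_sub (N v) (N w)] with x h1 h2 h3 h4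
    rw [h4, h3, Pi.sub_apply, Pi.sub_apply, h1, h2]
    exact hL (v x) (w x)
  have hNc : Continuous N := by
    refine (LipschitzWith.of_dist_le_mul (K := M.toNNReal) fun v w => ?_).continuous
    rw [dist_eq_norm, dist_eq_norm]
    exact (hNl v w).trans (mul_le_mul_of_nonneg_right (Real.le_coe_toNNReal M) (norm_nonneg _))
  set w : ℝ → Lp ℝ 2 μ := fun s => u (max s 0) with hw
  have hwc : Continuous w :=
    hu.comp_continuous (by fun_prop) (fun s => Set.mem_Ici.2 (le_max_right _ _))
  set g : ℝ → Lp ℝ 2 μ := fun s => T (w s) + N (w s) with hg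
  have hgc : Continuous g := (T.continuous.comp hwc).add (hNc.comp hwc)
  set U : ℝ → Lp ℝ 2 μ := fun t => u₀ + ∫ s in (0 : ℝ)..t, g s with hU
  have hUd : ∀ t, HasDerivAt U (g t) t := fun t =>
    (hgc.integral_hasStrictDerivAt 0 t).hasDerivAt.const_add _
  have hUu : ∀ t ≥ (0 : ℝ), U t = u t := by
    intro t ht
    rw [hueq t ht]
    simp only [hU]
    congr 1
    refine intervalIntegral.integral_congr fun s hs => ?_
    rw [Set.uIcc_of_le ht] at hs
    simp [hg, hw, max_eq_left hs.1]
  set k := Lp.const 2 μ c with hk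
  set P : ℝ → Lp ℝ 2 μ := fun t => Lp.posPart (U t - k) with hP
  set ψ : ℝ → ℝ := fun t => ‖P t‖ ^ 2 with hψ
  have hψd : ∀ t, HasDerivAt ψ (2 * inner ℝ (P t) (g t)) t := by
    intro t
    have := (posPart_hasFDerivAt (U t - k)).comp_hasDerivAt t ((hUd t).sub_const k)
    simpa [hψ, hP, Function.comp_def] using this
  have key : ∀ t ≥ (0 : ℝ), inner ℝ (P t) (g t) ≤ (‖T‖ + M) * ψ t := by
    intro t ht
    have hwt : w t = U t := by rw [hUu t ht]; simp [hw, max_eq_left ht]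
    have e1 : inner ℝ (P t) (T (U t)) ≤ ‖T‖ * ‖P t‖ ^ 2 := by
      refine (hT (U t)).trans ((real_inner_le_norm _ _).trans ?_)
      have := T.le_opNorm (P t)
      calc ‖P t‖ * ‖T (P t)‖ ≤ ‖P t‖ * (‖T‖ * ‖P t‖) := by gcongr
        _ = _ := by ring
    have e2 : inner ℝ (P t) (N (U t)) ≤ M * ‖P t‖ ^ 2 := by
      rw [← real_inner_self_eq_norm_sq, L2.inner_def, L2.inner_def, ← integral_const_mul]
      refine integral_mono_ae (L2.integrable_inner _ _) ((L2.integrable_inner _ _).const_mul M) ?_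
      filter_upwards [hN (U t), Lp.coeFn_posPart (U t - k), Lp.coeFn_sub (U t) k,
        Lp.coeFn_const (p := 2) (μ := μ) c] with x h1 h2 h3 h4
      have h5 : (P t : X → ℝ) x = max ((U t : X → ℝ) x - c) 0 := by
        simp only [hP]; rw [h2, h3, Pi.sub_apply, hk, h4]; rfl
      simp only [RCLike.inner_apply, conj_trivial, h1, h5]
      generalize (U t : X → ℝ) x = a
      rcases le_total a c with h | h
      · rw [max_eq_right (by linarith)]; simp
      · rw [max_eq_left (by linarith)]
        have := (le_abs_self _).trans (hL a c)
        rw [hc, abs_of_nonneg (sub_nonneg.2 h)] at this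
        nlinarith [sub_nonneg.2 h]
    simp only [hg, hwt, inner_add_right, hψ]
    linarith
  set L := ‖T‖ + M
  have hEd : ∀ t, HasDerivAt (fun t => Real.exp (-(2 * L) * t) * ψ t)
      (Real.exp (-(2 * L) * t) * (-(2 * L)) * ψ t
        + Real.exp (-(2 * L) * t) * (2 * inner ℝ (P t) (g t))) t := by
    intro t
    have h1 : HasDerivAt (fun t : ℝ => Real.exp (-(2 * L) * t))
        (Real.exp (-(2 * L) * t) * (-(2 * L))) t := by
      simpa using ((hasDerivAt_id t).const_mul (-(2 * L))).exp
    exact h1.mul (hψd t)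
  have hanti : AntitoneOn (fun t => Real.exp (-(2 * L) * t) * ψ t) (Set.Ici 0) := by
    refine antitoneOn_of_deriv_nonpos (convex_Ici 0)
      (fun t _ => (hEd t).continuousAt.continuousWithinAt)
      (fun t _ => (hEd t).differentiableAt.differentiableWithinAt) ?_
    intro t ht
    rw [interior_Ici] at ht
    rw [(hEd t).deriv]
    have := key t (le_of_lt ht)
    have := Real.exp_pos (-(2 * L) * t)
    nlinarith
  have hP0 : ψ 0 = 0 := by
    have : P 0 = 0 := by
      rw [Lp.eq_zero_iff_ae_eq_zero]
      filter_upwards [hinit, Lp.coeFn_posPart (U 0 - k), Lp.coeFn_sub (U 0) k,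
        Lp.coeFn_const (p := 2) (μ := μ) c] with x h1 h2 h3 h4
      simp only [hP]
      rw [h2, h3, Pi.sub_apply, hk, h4]
      have : U 0 = u₀ := by simp [hU]
      rw [this]
      simpa using h1
    simp [hψ, this]
  intro t ht
  have h1 := hanti (Set.mem_Ici.2 le_rfl) (Set.mem_Ici.2 ht.le) ht.le
  simp only [hP0, mul_zero] at h1
  have h2 : ψ t ≤ 0 := by
    by_contra! h
    exact absurd (mul_pos (Real.exp_pos (-(2 * L) * t)) h) (not_lt.2 h1)
  have h3 : P t = 0 := by
    have : ‖P t‖ ^ 2 = 0 := le_antisymm h2 (sq_nonneg _)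
    simpa using this
  rw [Lp.eq_zero_iff_ae_eq_zero] at h3
  filter_upwards [h3, Lp.coeFn_posPart (U t - k), Lp.coeFn_sub (U t) k,
        Lp.coeFn_const (p := 2) (μ := μ) c] with x h1 h2 h3 h4
  simp only [hP] at h1
  rw [h2, h3, Pi.sub_apply, hk, h4, hUu t ht.le] at h1
  simpa using h1

end Helpers

lemma Lop_ineq {n : ℕ} (Ω : Set (Fin n → ℝ)) (hΩm : MeasurableSet Ω)
    (hΩb : Bornology.IsBounded Ω) [IsFiniteMeasure (volume.restrict Ω)]
    (K : (Fin n → ℝ) → ℝ) (hKc : Continuous K) (hK : ∀ z, 0 ≤ K z)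
    (T : Lp ℝ 2 (volume.restrict Ω) →L[ℝ] Lp ℝ 2 (volume.restrict Ω))
    (hT : ∀ u : Lp ℝ 2 (volume.restrict Ω),
      (T u : (Fin n → ℝ) → ℝ) =ᵐ[volume.restrict Ω] fun x => Lop Ω K u x)
    (c : ℝ) (v : Lp ℝ 2 (volume.restrict Ω)) :
    inner ℝ (Lp.posPart (v - Lp.const 2 (volume.restrict Ω) c)) (T v) ≤
      inner ℝ (Lp.posPart (v - Lp.const 2 (volume.restrict Ω) c))
        (T (Lp.posPart (v - Lp.const 2 (volume.restrict Ω) c))) := by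
  have hint : ∀ (q : Lp ℝ 2 (volume.restrict Ω)) (x : Fin n → ℝ) (a : ℝ),
      Integrable (fun y => K (x - y) * ((q : (Fin n → ℝ) → ℝ) y - a)) (volume.restrict Ω) := by
    intro q x a
    obtain ⟨C, hC⟩ := hΩb.isCompact_closure.exists_bound_of_continuousOn
      (f := fun y => K (x - y)) (by fun_prop)
    have hq : Integrable (q : (Fin n → ℝ) → ℝ) (volume.restrict Ω) := (Lp.memLp q).integrable one_le_two
    refine (hq.sub (integrable_const a)).bdd_mul (c := C)
      (by fun_prop : Continuous fun y => K (x - y)).aestronglyMeasurable ?_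
    exact (ae_restrict_mem hΩm).mono fun y hy => hC y (subset_closure hy)
  set p := Lp.posPart (v - Lp.const 2 (volume.restrict Ω) c) with hp
  have hpe : ∀ᵐ x ∂(volume.restrict Ω), (p : (Fin n → ℝ) → ℝ) x = max ((v : (Fin n → ℝ) → ℝ) x - c) 0 := by
    filter_upwards [Lp.coeFn_posPart (v - Lp.const 2 (volume.restrict Ω) c), Lp.coeFn_sub v (Lp.const 2 (volume.restrict Ω) c),
        Lp.coeFn_const (p := 2) (μ := volume.restrict Ω) c] with x h2 h3 h4
    rw [h2, h3, Pi.sub_apply, h4]; rfl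
  rw [L2.inner_def, L2.inner_def]
  refine integral_mono_ae (L2.integrable_inner _ _) (L2.integrable_inner _ _) ?_
  filter_upwards [hT v, hT p, hpe] with x h1 h2 h3
  simp only [RCLike.inner_apply, conj_trivial, h1, h2]
  rcases le_total ((v : (Fin n → ℝ) → ℝ) x) c with h | h
  · rw [h3, max_eq_right (by linarith)]; simp
  · rw [max_eq_left (by linarith)] at h3
    refine mul_le_mul_of_nonneg_right ?_ (by rw [h3]; linarith)
    unfold Lop
    refine integral_mono_ae (hint _ _ _) (hint _ _ _) ?_
    filter_upwards [hpe] with y hy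
    refine mul_le_mul_of_nonneg_left ?_ (hK _)
    rw [hy, h3]
    linarith [le_max_left ((v : (Fin n → ℝ) → ℝ) y - c) 0]

/-- invariant region in `L²(Ω)`: if `u₁ ≤ u₀ ≤ u₂` a.e. in `Ω`
(where `u₁ < u₂` are zeros of `f`) then the solution of the evolution problem
satisfies `u₁ ≤ u(x,t) ≤ u₂` a.e. for every `t > 0`. -/
theorem stmt13 {n : ℕ} (Ω : Set (Fin n → ℝ)) (hΩo : IsOpen Ω)
    (hΩb : Bornology.IsBounded Ω)
    (J : (Fin n → ℝ) → ℝ) (hJc : Continuous J) (hJnn : ∀ z, 0 ≤ J z) (hJ0 : 0 < J 0)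
    (hJsymm : ∀ z, J (-z) = J z)
    (hJdec : Tendsto J (cocompact (Fin n → ℝ)) (nhds 0))
    (hJ2 : Integrable (fun z : Fin n → ℝ => J z * ∑ i, (z i) ^ 2))
    (hJ1 : (∫ z : Fin n → ℝ, J z) = 1)
    (ε m : ℝ) (hε : 0 < ε) (hm : m ∈ Set.Icc (0 : ℝ) 2)
    (f : ℝ → ℝ) (hf : ContDiff ℝ 1 f) (hf' : ∃ M, ∀ s, |deriv f s| ≤ M)
    (u₁ u₂ : ℝ) (h12 : u₁ < u₂) (hz1 : f u₁ = 0) (hz2 : f u₂ = 0)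
    (T : Lp ℝ 2 (volume.restrict Ω) →L[ℝ] Lp ℝ 2 (volume.restrict Ω))
    (hT : ∀ u : Lp ℝ 2 (volume.restrict Ω),
      (T u : (Fin n → ℝ) → ℝ) =ᵐ[volume.restrict Ω]
        fun x => Lop Ω (Jeps n J ε m) u x)
    (N : Lp ℝ 2 (volume.restrict Ω) → Lp ℝ 2 (volume.restrict Ω))
    (hN : ∀ v : Lp ℝ 2 (volume.restrict Ω),
      (N v : (Fin n → ℝ) → ℝ) =ᵐ[volume.restrict Ω] fun x => f (v x))
    (u₀ : Lp ℝ 2 (volume.restrict Ω))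
    (u : ℝ → Lp ℝ 2 (volume.restrict Ω))
    (hu : ContinuousOn u (Set.Ici 0))
    (hueq : ∀ t ≥ (0 : ℝ), u t = u₀ + ∫ s in (0 : ℝ)..t, (T (u s) + N (u s)))
    (hinit : ∀ᵐ x ∂(volume.restrict Ω),
      u₁ ≤ (u₀ : (Fin n → ℝ) → ℝ) x ∧ (u₀ : (Fin n → ℝ) → ℝ) x ≤ u₂) :
    ∀ t > (0 : ℝ), ∀ᵐ x ∂(volume.restrict Ω),
      u₁ ≤ (u t : (Fin n → ℝ) → ℝ) x ∧ (u t : (Fin n → ℝ) → ℝ) x ≤ u₂ := by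
  have hfin : IsFiniteMeasure (volume.restrict Ω) :=
    ⟨by simpa using hΩb.measure_lt_top⟩
  have hK : ∀ z, 0 ≤ Jeps n J ε m z := by
    intro z
    unfold Jeps
    have : 0 ≤ ∫ w : Fin n → ℝ, J w * ∑ i, (w i) ^ 2 :=
      integral_nonneg fun w => mul_nonneg (hJnn w) (Finset.sum_nonneg fun i _ => sq_nonneg _)
    have := hJnn (ε⁻¹ • z)
    positivity
  have hKc : Continuous (Jeps n J ε m) := by
    unfold Jeps
    fun_prop
  obtain ⟨M, hM⟩ := hf'
  have hL : ∀ a b, |f a - f b| ≤ M * |a - b| := by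
    intro a b
    have := Convex.norm_image_sub_le_of_norm_deriv_le (f := f) (s := Set.univ) (C := M)
      (x := b) (y := a) (fun x _ => (hf.differentiable one_ne_zero) x) (fun x _ => hM x)
      convex_univ (Set.mem_univ _) (Set.mem_univ _)
    simpa using this
  have hTi := Lop_ineq Ω hΩo.measurableSet hΩb _ hKc hK T hT
  have hup := upper_bound f M hL u₂ hz2 T (hTi u₂) N hN u₀ u hu hueq (hinit.mono fun x h => h.2)
  have hlo := upper_bound (fun s => - f (-s)) M
    (fun a b => by
      have := hL (-a) (-b)
      rw [abs_sub_comm] at this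
      rw [show -f (-a) - -f (-b) = f (-b) - f (-a) by ring, abs_sub_comm a b]
      rwa [show -a - -b = b - a by ring] at this) (-u₁) (by simp [hz1]) T (hTi (-u₁))
    (fun v => - N (-v))
    (fun v => by
      filter_upwards [hN (-v), Lp.coeFn_neg v, Lp.coeFn_neg (N (-v))] with x h1 h2 h3
      rw [h3, Pi.neg_apply, h1, h2, Pi.neg_apply])
    (-u₀) (fun t => - u t) hu.neg
    (fun t ht => by
      have : (fun s => T (-u s) + -N (- -u s)) = fun s => -(T (u s) + N (u s)) := by
        funext s
        rw [map_neg, neg_neg]; abel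
      simp only [this]
      rw [intervalIntegral.integral_neg, hueq t ht]; abel)
    (by
      filter_upwards [hinit, Lp.coeFn_neg u₀] with x h1 h2
      rw [h2, Pi.neg_apply]; linarith [h1.1])
  intro t ht
  filter_upwards [hup t ht, hlo t ht, Lp.coeFn_neg (u t)] with x h1 h2 h3
  rw [h3, Pi.neg_apply] at h2
  exact ⟨by linarith, h1⟩
end
end

section
/- Let Ω ⊂ ℝⁿ be open and bounded, let J_ε be the rescaled kernel of the general case, and let U ∈ L^∞(Ω) be such that ess sup_{x∈Ω} f'(U(x)) < 0, where f ∈ C¹(ℝ) with f' bounded. Let γ₀ = sup{ ⟨𝓛_ε φ + f'(U)φ, φ⟩ / ‖φ‖₂² : φ ∈ L²(Ω), φ ≠ 0 }. Then γ₀ ≤ ess sup_{x∈Ω} f'(U(x)) < 0, and every solution ψ ∈ C([0,∞), L²(Ω)) of the linearized problem ψ(t) = ψ₀ + ∫₀ᵗ (𝓛_ε ψ(s) + f'(U)ψ(s)) ds satisfies ‖ψ(t)‖_{L²(Ω)}² ≤ ‖ψ₀‖_{L²(Ω)}² e^{γ₀ t} for all t ≥ 0; i.e. the steady state U is linearly exponentially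 stable in L²(Ω). -/
open MeasureTheory Real Filter

noncomputable section

theorem essSup_zero_aux {α : Type*} [MeasurableSpace α] (g : α → ℝ) (μ : Measure α)
    (h : μ = 0) : essSup g μ = 0 := by
  subst h
  simp [essSup, limsup, limsSup]

/-- Abstract energy estimate for a bounded linear evolution equation. -/
theorem energy_aux {H : Type*} [NormedAddCommGroup H] [InnerProductSpace ℝ H] [CompleteSpace H]
    (A : H →L[ℝ] H) (g : ℝ) (hg : g ≤ 0) (hA : ∀ φ : H, inner ℝ (A φ) φ ≤ g * ‖φ‖ ^ 2)
    (ψ₀ : H) (ψ : ℝ → H) (hc : ContinuousOn ψ (Set.Ici 0))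
    (hψ : ∀ t ≥ (0 : ℝ), ψ t = ψ₀ + ∫ s in (0 : ℝ)..t, A (ψ s)) (t : ℝ) (ht : 0 ≤ t) :
    ‖ψ t‖ ^ 2 ≤ ‖ψ₀‖ ^ 2 * Real.exp (g * t) := by
  have hcm : Continuous (fun s : ℝ => ψ (max s 0)) := by
    apply hc.comp_continuous (by fun_prop)
    intro x
    simp
  have hch : Continuous (fun s : ℝ => A (ψ (max s 0))) := A.continuous.comp hcm
  set Ψ : ℝ → H := fun t => ψ₀ + ∫ s in (0 : ℝ)..t, A (ψ (max s 0)) with hΨ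
  have hΨd : ∀ t, HasDerivAt Ψ (A (ψ (max t 0))) t := by
    intro t
    exact (hch.integral_hasStrictDerivAt 0 t).hasDerivAt.const_add ψ₀
  have heq : ∀ t ≥ (0 : ℝ), Ψ t = ψ t := by
    intro t ht
    rw [hψ t ht, hΨ]
    simp only
    congr 1
    apply intervalIntegral.integral_congr
    intro s hs
    rw [Set.uIcc_of_le ht] at hs
    simp [max_eq_left hs.1]
  have hGd : ∀ t, HasDerivAt (fun t => ‖Ψ t‖ ^ 2 * Real.exp (-(g * t)))
      ((2 * inner ℝ (Ψ t) (A (ψ (max t 0)))) * Real.exp (-(g * t))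
        + ‖Ψ t‖ ^ 2 * (Real.exp (-(g * t)) * -(g * 1))) t := by
    intro t
    exact (hΨd t).norm_sq.mul (((hasDerivAt_id t).const_mul g).neg.exp)
  have hanti : AntitoneOn (fun t => ‖Ψ t‖ ^ 2 * Real.exp (-(g * t))) (Set.Ici 0) := by
    apply antitoneOn_of_deriv_nonpos (convex_Ici 0)
    · exact fun x _ => (hGd x).continuousAt.continuousWithinAt
    · exact fun x _ => (hGd x).differentiableAt.differentiableWithinAt
    · intro x hx
      rw [interior_Ici] at hx
      have hx0 : (0 : ℝ) ≤ x := le_of_lt hx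
      rw [(hGd x).deriv, max_eq_left hx0, heq x hx0, real_inner_comm]
      have h1 := hA (ψ x)
      have h2 := Real.exp_pos (-(g * x))
      have h3 : g * ‖ψ x‖ ^ 2 ≤ 0 := mul_nonpos_of_nonpos_of_nonneg hg (by positivity)
      have h4 : (2 * inner ℝ (A (ψ x)) (ψ x) - g * ‖ψ x‖ ^ 2) * Real.exp (-(g * x)) ≤ 0 :=
        mul_nonpos_of_nonpos_of_nonneg (by linarith) h2.le
      linarith
  have h := hanti (Set.mem_Ici.2 le_rfl) (Set.mem_Ici.2 ht) ht
  simp only [heq t ht] at h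
  have h0 : Ψ 0 = ψ₀ := by simp [hΨ]
  rw [h0] at h
  simp only [mul_zero, neg_zero, Real.exp_zero, mul_one] at h
  calc ‖ψ t‖ ^ 2 = ‖ψ t‖ ^ 2 * Real.exp (-(g * t)) * Real.exp (g * t) := by
        rw [mul_assoc, ← Real.exp_add]; simp
    _ ≤ _ := mul_le_mul_of_nonneg_right h (Real.exp_pos _).le

/-- linear exponential stability: if `ess sup_Ω f'(U) < 0` then
`γ₀ = sup { ⟨𝓛_ε φ + f'(U)φ, φ⟩/‖φ‖₂² } ≤ ess sup_Ω f'(U) < 0`, and every solution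
of the linearized problem satisfies `‖ψ(t)‖₂² ≤ ‖ψ₀‖₂² e^{γ₀ t}`. -/
theorem stmt19 {n : ℕ} (Ω : Set (Fin n → ℝ)) (hΩo : IsOpen Ω)
    (hΩb : Bornology.IsBounded Ω)
    (J : (Fin n → ℝ) → ℝ) (hJc : Continuous J) (hJnn : ∀ z, 0 ≤ J z) (hJ0 : 0 < J 0)
    (hJsymm : ∀ z, J (-z) = J z)
    (hJdec : Tendsto J (cocompact (Fin n → ℝ)) (nhds 0))
    (hJ2 : Integrable (fun z : Fin n → ℝ => J z * ∑ i, (z i) ^ 2))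
    (hJ1 : (∫ z : Fin n → ℝ, J z) = 1)
    (ε m : ℝ) (hε : 0 < ε) (hm : m ∈ Set.Icc (0 : ℝ) 2)
    (f : ℝ → ℝ) (hf : ContDiff ℝ 1 f) (hf' : ∃ M, ∀ s, |deriv f s| ≤ M)
    (U : Lp ℝ ⊤ (volume.restrict Ω))
    (hneg : essSup (fun x => deriv f ((U : (Fin n → ℝ) → ℝ) x))
      (volume.restrict Ω) < 0)
    (T : Lp ℝ 2 (volume.restrict Ω) →L[ℝ] Lp ℝ 2 (volume.restrict Ω))
    (hT : ∀ u : Lp ℝ 2 (volume.restrict Ω),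
      (T u : (Fin n → ℝ) → ℝ) =ᵐ[volume.restrict Ω]
        fun x => Lop Ω (Jeps n J ε m) u x)
    (hTdiss : ∀ φ : Lp ℝ 2 (volume.restrict Ω),
      (∫ x, (T φ : (Fin n → ℝ) → ℝ) x * (φ : (Fin n → ℝ) → ℝ) x
          ∂(volume.restrict Ω)) ≤ 0)
    (M : Lp ℝ 2 (volume.restrict Ω) →L[ℝ] Lp ℝ 2 (volume.restrict Ω))
    (hM : ∀ φ : Lp ℝ 2 (volume.restrict Ω),
      (M φ : (Fin n → ℝ) → ℝ) =ᵐ[volume.restrict Ω]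
        fun x => deriv f ((U : (Fin n → ℝ) → ℝ) x) * (φ : (Fin n → ℝ) → ℝ) x) :
    (sSup {r : ℝ | ∃ φ : Lp ℝ 2 (volume.restrict Ω), φ ≠ 0 ∧
        r = (∫ x, ((T φ : (Fin n → ℝ) → ℝ) x
                + deriv f ((U : (Fin n → ℝ) → ℝ) x) * (φ : (Fin n → ℝ) → ℝ) x)
                  * (φ : (Fin n → ℝ) → ℝ) x ∂(volume.restrict Ω)) / ‖φ‖ ^ 2}
      ≤ essSup (fun x => deriv f ((U : (Fin n → ℝ) → ℝ) x)) (volume.restrict Ω)) ∧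
    ∀ ψ₀ : Lp ℝ 2 (volume.restrict Ω), ∀ ψ : ℝ → Lp ℝ 2 (volume.restrict Ω),
      ContinuousOn ψ (Set.Ici 0) →
      (∀ t ≥ (0 : ℝ), ψ t = ψ₀ + ∫ s in (0 : ℝ)..t, (T (ψ s) + M (ψ s))) →
      ∀ t ≥ (0 : ℝ),
        ‖ψ t‖ ^ 2 ≤ ‖ψ₀‖ ^ 2 *
          Real.exp ((sSup {r : ℝ | ∃ φ : Lp ℝ 2 (volume.restrict Ω), φ ≠ 0 ∧
            r = (∫ x, ((T φ : (Fin n → ℝ) → ℝ) x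
                    + deriv f ((U : (Fin n → ℝ) → ℝ) x) * (φ : (Fin n → ℝ) → ℝ) x)
                      * (φ : (Fin n → ℝ) → ℝ) x ∂(volume.restrict Ω)) / ‖φ‖ ^ 2}) * t) := by
  set E := essSup (fun x => deriv f ((U : (Fin n → ℝ) → ℝ) x)) (volume.restrict Ω) with hE
  set S := {r : ℝ | ∃ φ : Lp ℝ 2 (volume.restrict Ω), φ ≠ 0 ∧
        r = (∫ x, ((T φ : (Fin n → ℝ) → ℝ) x
                + deriv f ((U : (Fin n → ℝ) → ℝ) x) * (φ : (Fin n → ℝ) → ℝ) x)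
                  * (φ : (Fin n → ℝ) → ℝ) x ∂(volume.restrict Ω)) / ‖φ‖ ^ 2} with hS
  obtain ⟨C, hC⟩ := hf'
  have hae : ∀ᵐ x ∂(volume.restrict Ω), deriv f ((U : (Fin n → ℝ) → ℝ) x) ≤ E := by
    refine ae_le_essSup ?_
    exact isBoundedUnder_of ⟨C, fun x => (abs_le.1 (hC _)).2⟩
  have hinner : ∀ φ : Lp ℝ 2 (volume.restrict Ω), inner ℝ ((T + M) φ) φ =
      ∫ x, ((T φ : (Fin n → ℝ) → ℝ) x
                + deriv f ((U : (Fin n → ℝ) → ℝ) x) * (φ : (Fin n → ℝ) → ℝ) x)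
                  * (φ : (Fin n → ℝ) → ℝ) x ∂(volume.restrict Ω) := by
    intro φ
    rw [L2.inner_def]
    apply integral_congr_ae
    filter_upwards [hM φ, Lp.coeFn_add (T φ) (M φ)] with x h1 h2
    simp only [_root_.add_apply, h2, Pi.add_apply, h1]
    simp [mul_comm]
  have hTin : ∀ φ : Lp ℝ 2 (volume.restrict Ω), inner ℝ (T φ) φ ≤ 0 := by
    intro φ
    rw [L2.inner_def]
    refine le_trans (le_of_eq ?_) (hTdiss φ)
    apply integral_congr_ae
    filter_upwards with x
    simp [mul_comm]
  have hMin : ∀ φ : Lp ℝ 2 (volume.restrict Ω), inner ℝ (M φ) φ ≤ E * ‖φ‖ ^ 2 := by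
    intro φ
    rw [← real_inner_self_eq_norm_sq, ← real_inner_smul_left, L2.inner_def, L2.inner_def]
    apply integral_mono_ae (L2.integrable_inner _ _) (L2.integrable_inner _ _)
    filter_upwards [hM φ, Lp.coeFn_smul E φ, hae] with x h1 h2 h3
    simp only [h1, h2, Pi.smul_apply, smul_eq_mul, RCLike.inner_apply, conj_trivial]
    nlinarith [mul_le_mul_of_nonneg_right h3 (mul_self_nonneg ((φ : (Fin n → ℝ) → ℝ) x))]
  have hle : ∀ φ : Lp ℝ 2 (volume.restrict Ω), inner ℝ ((T + M) φ) φ ≤ E * ‖φ‖ ^ 2 := by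
    intro φ
    rw [_root_.add_apply, inner_add_left]
    linarith [hTin φ, hMin φ]
  have hub : ∀ r ∈ S, r ≤ E := by
    rintro r ⟨φ, hφ, rfl⟩
    rw [← hinner φ, div_le_iff₀ (by positivity)]
    exact hle φ
  have hμ0 : (volume.restrict Ω) ≠ 0 := by
    intro h0
    have : E = 0 := by
      exact essSup_zero_aux _ _ h0
    linarith
  have hfin : IsFiniteMeasure (volume.restrict Ω) := ⟨by
    rw [Measure.restrict_apply_univ]
    exact hΩb.measure_lt_top⟩
  have hne : S.Nonempty := by
    have hφ : (indicatorConstLp 2 MeasurableSet.univ (measure_ne_top (volume.restrict Ω) _) (1 : ℝ)) ≠ 0 := by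
      intro h
      have h2 := congrArg norm h
      rw [norm_indicatorConstLp (by norm_num) (by norm_num), norm_zero] at h2
      have h3 : (volume.restrict Ω).real Set.univ ≠ 0 := by
        rw [measureReal_ne_zero_iff]
        simpa using hμ0
      have h4 : 0 < (volume.restrict Ω).real Set.univ := lt_of_le_of_ne measureReal_nonneg h3.symm
      have h5 := Real.rpow_pos_of_pos h4 (1 / (2 : ENNReal).toReal)
      simp only [norm_one, one_mul] at h2
      exact h5.ne' h2
    exact ⟨_, _, hφ, rfl⟩
  have hγ : sSup S ≤ E := csSup_le hne hub
  refine ⟨hγ, ?_⟩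
  intro ψ₀ ψ hc hψ t ht
  refine energy_aux (T + M) (sSup S) (by linarith) ?_ ψ₀ ψ hc (fun t ht => by simpa using hψ t ht) t ht
  intro φ
  by_cases hφ : φ = 0
  · simp [hφ]
  · rw [← div_le_iff₀ (by positivity), hinner φ]
    exact le_csSup ⟨E, hub⟩ ⟨φ, hφ, rfl⟩
end
end
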